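/- arXiv:1508.05437 — 2 statements merged into one kernel-verified Lean document; each statement's English description precedes it below -/
import Mathlib

section
/- Let μ₁, ..., μ_N be finite Borel measures on ℝ^(n+1), each of which vanishes on the zero set of every nonzero polynomial of degree at most c_n N^(1/(n+1)) (for a suitable dimensional constant c_n). Then there exists a nonzero polynomial P on ℝ^(n+1) of degree at most c_n N^(1/(n+1)) such that for each 1 ≤ j ≤ N, μ_j({P > 0}) = μ_j({P < 0}). -/
open MeasureTheory

namespace HamSandwich

/-- Chains: formal sums mod 2 of lists of vertices. -/
abbrev Ch (V : Type) := List V →₀ ZMod 2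

noncomputable section

/-- linear extension -/
abbrev ext {V : Type} {M : Type} [AddCommGroup M] [Module (ZMod 2) M] (g : List V → M) :
    Ch V →ₗ[ZMod 2] M := Finsupp.linearCombination (ZMod 2) g

abbrev sg {V : Type} (l : List V) : Ch V := Finsupp.single l 1

/-- cone operator -/
def cone {V : Type} (b : V) : Ch V →ₗ[ZMod 2] Ch V := ext (fun l => sg (b :: l))

/-- boundary of a list -/
def bd0 {V : Type} : List V → Ch V
  | [] => 0
  | v :: l => sg l + cone v (bd0 l)

def bd {V : Type} : Ch V →ₗ[ZMod 2] Ch V := ext bd0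

variable {V : Type}

lemma ext_sg {M : Type} [AddCommGroup M] [Module (ZMod 2) M] (g : List V → M) (l : List V) :
    ext g (sg l) = g l := by simp [ext, sg]

lemma two_zero {M : Type} [AddCommGroup M] [Module (ZMod 2) M] (x : M) : x + x = 0 := by
  have : (2 : ZMod 2) • x = 0 := by
    rw [show (2 : ZMod 2) = 0 from rfl, zero_smul]
  rwa [two_smul] at this

lemma hom_ext {M : Type} [AddCommGroup M] [Module (ZMod 2) M] {f g : Ch V →ₗ[ZMod 2] M}
    (h : ∀ l, f (sg l) = g (sg l)) : f = g := by
  apply Finsupp.lhom_ext'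
  intro l
  apply LinearMap.ext_ring
  simpa using h l

lemma ext_congr {M : Type} [AddCommGroup M] [Module (ZMod 2) M] {f g : Ch V →ₗ[ZMod 2] M}
    (c : Ch V) (h : ∀ l ∈ c.support, f (sg l) = g (sg l)) : f c = g c := by
  have hc : c = ∑ l ∈ c.support, c l • sg l := by
    conv_lhs => rw [← Finsupp.sum_single c]
    simp [Finsupp.sum, sg]
  rw [hc, map_sum, map_sum]
  refine Finset.sum_congr rfl fun l hl => ?_
  rw [map_smul, map_smul, h l hl]

lemma cone_sg (b : V) (l : List V) : cone b (sg l) = sg (b :: l) := ext_sg _ _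

lemma bd_sg (l : List V) : bd (sg l) = bd0 l := ext_sg _ _

lemma bd_sg_cons (v : V) (l : List V) : bd (sg (v :: l)) = sg l + cone v (bd (sg l)) := by
  rw [bd_sg, bd_sg, bd0]

lemma bd_cone (b : V) (c : Ch V) : bd (cone b c) = c + cone b (bd c) := by
  have : bd ∘ₗ cone b = LinearMap.id + cone b ∘ₗ bd := by
    apply hom_ext
    intro l
    simp [cone_sg, bd_sg_cons]
  simpa using LinearMap.congr_fun this c

lemma bd_bd (c : Ch V) : bd (bd c) = 0 := by
  have : (bd : Ch V →ₗ[ZMod 2] Ch V) ∘ₗ bd = 0 := by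
    apply hom_ext
    intro l
    induction l with
    | nil => simp [bd_sg, bd0]
    | cons v l ih =>
      have ih' : bd (bd (sg l)) = 0 := by simpa using ih
      simp only [LinearMap.comp_apply, bd_sg_cons, map_add, bd_cone, ih', map_zero, add_zero,
        LinearMap.zero_apply]
      exact two_zero _
  simpa using LinearMap.congr_fun this c

/-- the map induced by vertex map -/
def mp (f : V → V) : Ch V →ₗ[ZMod 2] Ch V := ext (fun l => sg (l.map f))

lemma mp_sg (f : V → V) (l : List V) : mp f (sg l) = sg (l.map f) := ext_sg _ _

lemma mp_cone (f : V → V) (b : V) (c : Ch V) : mp f (cone b c) = cone (f b) (mp f c) := by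
  have : mp f ∘ₗ cone b = cone (f b) ∘ₗ mp f := by
    apply hom_ext
    intro l
    simp [cone_sg, mp_sg]
  simpa using LinearMap.congr_fun this c

lemma mp_bd (f : V → V) (c : Ch V) : mp f (bd c) = bd (mp f c) := by
  have : mp f ∘ₗ bd = bd ∘ₗ mp f := by
    apply hom_ext
    intro l
    induction l with
    | nil => simp [bd_sg, mp_sg, bd0]
    | cons v l ih =>
      have ih' : mp f (bd (sg l)) = bd (sg (l.map f)) := by simpa [mp_sg] using ih
      simp only [LinearMap.comp_apply, bd_sg_cons, map_add, mp_cone, ih', mp_sg, List.map_cons]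
  simpa using LinearMap.congr_fun this c

/-! cochains -/

/-- cup product of coboundaries of the functions `us`. -/
def phi : List (V → ZMod 2) → List V → ZMod 2
  | [], [_] => 1
  | [], _ => 0
  | u :: us, v :: w :: l => (u v + u w) * phi us (w :: l)
  | _ :: _, _ => 0

def psi (u : V → ZMod 2) (us : List (V → ZMod 2)) : List V → ZMod 2
  | [] => 0
  | v :: l => u v * phi us (v :: l)

lemma phi_nil (us : List (V → ZMod 2)) : phi us [] = 0 := by
  cases us <;> rfl

lemma psi_cone (u : V → ZMod 2) (us : List (V → ZMod 2)) (v : V) (c : Ch V) :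
    ext (psi u us) (cone v c) = u v * ext (phi us) (cone v c) := by
  have : ext (psi u us) ∘ₗ cone v = u v • (ext (phi us) ∘ₗ cone v) := by
    apply hom_ext
    intro l
    simp only [LinearMap.comp_apply, cone_sg, LinearMap.smul_apply, ext_sg, psi, smul_eq_mul]
  simpa using LinearMap.congr_fun this c

lemma phi_cocycle_psi (us : List (V → ZMod 2)) :
    (∀ c, ext (phi us) (bd c) = 0) ∧
      ∀ u c, ext (psi u us) (bd c) = ext (phi (u :: us)) c := by
  have key : ∀ us : List (V → ZMod 2), (∀ c, ext (phi us) (bd c) = 0) →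
      ∀ u c, ext (psi u us) (bd c) = ext (phi (u :: us)) c := by
    intro us h u c
    have : ext (psi u us) ∘ₗ bd = ext (phi (u :: us)) := by
      apply hom_ext
      intro l
      rw [LinearMap.comp_apply, ext_sg]
      match l with
      | [] => simp [bd_sg, bd0, phi]
      | [v] =>
        rw [bd_sg_cons, map_add, ext_sg, psi_cone]
        simp [bd_sg, bd0, phi, psi]
      | v :: w :: l =>
        have h1 := h (sg (v :: w :: l))
        rw [bd_sg_cons, map_add, ext_sg] at h1
        rw [bd_sg_cons, map_add, ext_sg, psi_cone]
        have h2 : ext (phi us) (cone v (bd (sg (w :: l)))) = phi us (w :: l) := by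
          have h3 := two_zero (phi us (w :: l))
          linear_combination h1 - h3
        rw [h2]
        simp only [psi, phi]
        ring
    exact LinearMap.congr_fun this c
  have coc : ∀ us : List (V → ZMod 2), (∀ c, ext (phi us) (bd c) = 0) := by
    intro us
    induction us with
    | nil =>
      intro c
      have : ext (phi ([] : List (V → ZMod 2))) ∘ₗ bd = 0 := by
        apply hom_ext
        intro l
        rw [LinearMap.comp_apply]
        match l with
        | [] => simp [bd_sg, bd0]
        | [v] =>
          simp [bd_sg, bd0, phi]
        | [v, w] =>
          simp only [bd_sg_cons, map_add, cone_sg, ext_sg]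
          simp [bd_sg, bd0, phi]
          rfl
        | v :: w :: x :: l =>
          have h0 : ∀ c : Ch V, ext (phi ([] : List (V → ZMod 2))) (cone v (cone w c)) = 0 := by
            intro c
            have : ext (phi ([] : List (V → ZMod 2))) ∘ₗ cone v ∘ₗ cone w = 0 := by
              apply hom_ext
              intro l
              simp only [LinearMap.comp_apply, cone_sg, ext_sg, phi, LinearMap.zero_apply]
            simpa using LinearMap.congr_fun this c
          rw [bd_sg_cons v, bd_sg_cons w, map_add, map_add, map_add, h0, cone_sg, ext_sg, ext_sg]
          simp [phi]
      exact LinearMap.congr_fun this c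
    | cons u us ih =>
      intro c
      rw [← key us ih, bd_bd, map_zero]
  exact ⟨coc us, key us (coc us)⟩

lemma phi_const (us : List (V → ZMod 2)) (l : List V) (u : V → ZMod 2) (hu : u ∈ us)
    (h : ∀ v ∈ l, ∀ w ∈ l, u v = u w) : phi us l = 0 := by
  induction us generalizing l with
  | nil => simp at hu
  | cons a us ih =>
    match l with
    | [] => rfl
    | [v] => rfl
    | v :: w :: l =>
      simp only [phi]
      rcases List.mem_cons.1 hu with rfl | hu
      · rw [h v (by simp) w (by simp), two_zero, zero_mul]
      · rw [ih (w :: l) hu, mul_zero]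
        intro x hx y hy
        exact h x (List.mem_cons_of_mem _ hx) y (List.mem_cons_of_mem _ hy)

lemma phi_neg (f : V → V) (us : List (V → ZMod 2)) (l : List V)
    (h : ∀ u ∈ us, ∀ v ∈ l, u (f v) = u v + 1) : phi us (l.map f) = phi us l := by
  induction us generalizing l with
  | nil =>
    match l with
    | [] => rfl
    | [v] => rfl
    | v :: w :: l => rfl
  | cons a us ih =>
    match l with
    | [] => rfl
    | [v] => rfl
    | v :: w :: l =>
      have := ih (w :: l) (fun u hu v hv => h u (by simp [hu]) v (List.mem_cons_of_mem _ hv))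
      simp only [List.map_cons] at this
      simp only [phi, List.map_cons]
      rw [this, h a (by simp) v (by simp), h a (by simp) w (by simp)]
      have := two_zero (1 : ZMod 2)
      linear_combination phi us (w :: l) * this

lemma psi_neg (f : V → V) (u : V → ZMod 2) (us : List (V → ZMod 2)) (l : List V)
    (h : ∀ u' ∈ u :: us, ∀ v ∈ l, u' (f v) = u' v + 1) :
    psi u us l + psi u us (l.map f) = phi us l := by
  match l with
  | [] => simp [psi, phi_nil]
  | v :: l =>
    have := phi_neg f us (v :: l) (fun u hu => h u (by simp [hu]))
    simp only [List.map_cons] at this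
    simp only [psi, List.map_cons, this, h u (by simp) v (by simp)]
    have := two_zero (u v)
    linear_combination phi us (v :: l) * this

/-- the pairing is one -/
lemma pairing (f : V → V) (c : ℕ → Ch V) (e : V) (h0 : c 0 = sg [e])
    (N : ℕ) (hc : ∀ k < N, bd (c (k + 1)) = c k + mp f (c k)) (us : List (V → ZMod 2))
    (hN : us.length ≤ N)
    (h : ∀ u ∈ us, ∀ k < N, ∀ l ∈ (c k).support, ∀ v ∈ l, u (f v) = u v + 1) :
    ext (phi us) (c us.length) = 1 := by
  induction us with
  | nil => simp [h0, phi]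
  | cons u us ih =>
    simp only [List.length_cons] at hN ⊢
    rw [← (phi_cocycle_psi us).2, hc _ (by omega), map_add,
      ← ih (by omega) (fun u hu => h u (by simp [hu]))]
    have := ext_congr (f := ext (psi u us) + ext (psi u us) ∘ₗ mp f) (g := ext (phi us))
      (c us.length) (by
        intro l hl
        simp only [LinearMap.add_apply, LinearMap.comp_apply, mp_sg, ext_sg]
        exact psi_neg f u us l (fun u' hu' => h u' hu' _ (by omega) l hl))
    simpa using this

/-! supports -/

/-- all lists in the chain satisfy `P` -/
def All (P : List V → Prop) (c : Ch V) : Prop := ∀ l ∈ c.support, P l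

lemma All.add {P : List V → Prop} {c d : Ch V} (hc : All P c) (hd : All P d) : All P (c + d) := by
  classical
  intro l hl
  rcases Finset.mem_union.1 (Finsupp.support_add hl) with h | h
  exacts [hc l h, hd l h]

lemma All.zero {P : List V → Prop} : All P (0 : Ch V) := by
  intro l hl; simp at hl

lemma All.smul {P : List V → Prop} {c : Ch V} (a : ZMod 2) (hc : All P c) : All P (a • c) :=
  fun l hl => hc l (Finsupp.support_smul hl)

lemma All.sg {P : List V → Prop} {l : List V} (h : P l) : All P (sg l) := by
  intro l' hl
  have := Finsupp.support_single_subset hl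
  simp at this
  rwa [this]

lemma All.sum {ι : Type} {P : List V → Prop} (s : Finset ι) (g : ι → Ch V)
    (h : ∀ i ∈ s, All P (g i)) : All P (∑ i ∈ s, g i) := by
  classical
  induction s using Finset.induction_on with
  | empty => simpa using All.zero
  | insert a s ha ih =>
    rw [Finset.sum_insert ha]
    exact (h a (by simp)).add (ih fun i hi => h i (by simp [hi]))

lemma All.ext {P : List V → Prop} {c : Ch V} (g : List V → Ch V)
    (h : ∀ l ∈ c.support, All P (g l)) : All P (ext g c) := by
  rw [HamSandwich.ext, Finsupp.linearCombination_apply, Finsupp.sum]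
  exact All.sum _ _ fun l hl => (h l hl).smul _

lemma All.cone {P Q : List V → Prop} {c : Ch V} (b : V) (hc : All P c)
    (h : ∀ l, P l → Q (b :: l)) : All Q (cone b c) :=
  All.ext _ fun l hl => All.sg (h l (hc l hl))

lemma All.mp {P Q : List V → Prop} {c : Ch V} (f : V → V) (hc : All P c)
    (h : ∀ l, P l → Q (l.map f)) : All Q (mp f c) :=
  All.ext _ fun l hl => All.sg (h l (hc l hl))

lemma All.mono {P Q : List V → Prop} {c : Ch V} (hc : All P c)
    (h : ∀ l, P l → Q l) : All Q c := fun l hl => h l (hc l hl)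

lemma All.bd0 (l : List V) : All (fun l' => l'.length + 1 = l.length ∧ ∀ v ∈ l', v ∈ l) (bd0 l) := by
  induction l with
  | nil => exact All.zero
  | cons v l ih =>
    rw [HamSandwich.bd0]
    refine (All.sg ⟨rfl, fun w hw => List.mem_cons_of_mem _ hw⟩).add
      (ih.cone v ?_)
    rintro l' ⟨h1, h2⟩
    refine ⟨by simp [h1], ?_⟩
    intro w hw
    rcases List.mem_cons.1 hw with rfl | hw
    · simp
    · exact List.mem_cons_of_mem _ (h2 w hw)

/-! subdivision -/

section sd
variable [NormedAddCommGroup V] [NormedSpace ℝ V]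

def bary (l : List V) : V := (l.length : ℝ)⁻¹ • l.sum

def sdF : ℕ → List V → Ch V
  | 0, l => sg l
  | m + 1, l => cone (bary l) (ext (sdF m) (bd0 l))

lemma bd_sdF (m : ℕ) : ∀ l : List V, l.length = m + 1 →
    bd (sdF (m + 1) l) = ext (sdF m) (bd0 l) := by
  induction m with
  | zero =>
    intro l hl
    obtain ⟨v, rfl⟩ := List.length_eq_one_iff.1 hl
    simp [sdF, bd0, bd_cone, bd_sg]
  | succ m ih =>
    intro l hl
    rw [sdF, bd_cone]
    have : bd (ext (sdF (m + 1)) (bd0 l)) = 0 := by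
      have h := ext_congr (f := bd ∘ₗ ext (sdF (m + 1))) (g := ext (sdF m) ∘ₗ bd) (bd0 l) (by
        intro l' hl'
        have := (All.bd0 l l' hl').1
        simp only [LinearMap.comp_apply, ext_sg, bd_sg]
        exact ih l' (by omega))
      simp only [LinearMap.comp_apply] at h
      rw [h, ← bd_sg, bd_bd, map_zero]
    rw [this, map_zero, add_zero]

lemma bary_neg (l : List V) : bary (l.map (fun v => -v)) = - bary l := by
  have : (l.map (fun v => -v)).sum = - l.sum := by
    induction l with
    | nil => simp
    | cons v l ih => simp [ih]; abel
  simp [bary, this]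

lemma sdF_neg (m : ℕ) (l : List V) :
    mp (fun v => -v) (sdF m l) = sdF m (l.map (fun v => -v)) := by
  induction m generalizing l with
  | zero => simp only [sdF, mp_sg]
  | succ m ih =>
    rw [sdF, mp_cone, sdF, bary_neg]
    congr 1
    rw [← bd_sg, ← bd_sg, ← mp_sg, ← mp_bd]
    have h : mp (fun v => -v) ∘ₗ ext (sdF m) = ext (sdF m) ∘ₗ mp (fun v : V => -v) := by
      apply hom_ext
      intro l
      simp only [LinearMap.comp_apply, ext_sg, mp_sg, ih]
    exact LinearMap.congr_fun h _

lemma bary_mem {l : List V} (hl : l ≠ []) {C : Set V} (hC : Convex ℝ C) (h : ∀ v ∈ l, v ∈ C) :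
    bary l ∈ C := by
  have hpos : 0 < l.length := List.length_pos_iff.2 hl
  have hs : l.sum = ∑ i : Fin l.length, l.get i := by
    rw [← List.sum_ofFn, List.ofFn_get]
  rw [bary, hs, Finset.smul_sum]
  apply hC.sum_mem
  · intro i _; positivity
  · simp; field_simp
  · intro i _; exact h _ (List.get_mem _ _)

lemma bary_dist {l : List V} {D : ℝ} (h : ∀ v ∈ l, ∀ w ∈ l, dist v w ≤ D)
    (v : V) (hv : v ∈ l) : dist v (bary l) ≤ (1 - 1 / (l.length : ℝ)) * D := by
  have hpos : 0 < (l.length : ℝ) := by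
    exact_mod_cast List.length_pos_iff.2 (List.ne_nil_of_mem hv)
  have hs : l.sum = ∑ i : Fin l.length, l.get i := by
    rw [← List.sum_ofFn, List.ofFn_get]
  obtain ⟨j, rfl⟩ := List.get_of_mem hv
  have h1 : l.get j - bary l = (l.length : ℝ)⁻¹ • ∑ i : Fin l.length, (l.get j - l.get i) := by
    rw [Finset.sum_sub_distrib, ← hs, smul_sub, bary]
    simp only [Finset.sum_const, Finset.card_univ, Fintype.card_fin]
    rw [← Nat.cast_smul_eq_nsmul ℝ, smul_smul, inv_mul_cancel₀ hpos.ne', one_smul]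
  have h2 : ‖∑ i : Fin l.length, (l.get j - l.get i)‖ ≤ (l.length - 1) * D := by
    rw [← Finset.sum_erase (Finset.univ) (a := j) (by simp)]
    refine (norm_sum_le_of_le _ (fun i _ => (dist_eq_norm (l.get j) (l.get i)) ▸
      h _ (List.get_mem _ _) _ (List.get_mem _ _))).trans ?_
    have : 1 ≤ l.length := by exact_mod_cast hpos
    simp [Finset.card_erase_of_mem, Nat.cast_sub this]
  rw [dist_eq_norm, h1, norm_smul, norm_inv, Real.norm_of_nonneg hpos.le]
  calc _ ≤ (l.length : ℝ)⁻¹ * ((l.length - 1) * D) := by gcongr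
    _ = _ := by field_simp

lemma sdF_all (M : ℕ) (m : ℕ) : ∀ (l : List V) (D : ℝ), 0 ≤ D → l.length = m → m ≤ M →
    (∀ v ∈ l, ∀ w ∈ l, dist v w ≤ D) →
    All (fun t => t.length = m ∧ (∀ C : Set V, Convex ℝ C → (∀ v ∈ l, v ∈ C) → ∀ v ∈ t, v ∈ C) ∧
      ∀ v ∈ t, ∀ w ∈ t, dist v w ≤ (1 - 1 / (M : ℝ)) * D) (sdF m l) := by
  induction m with
  | zero =>
    intro l D hD hl _ _
    rw [List.length_eq_zero_iff] at hl
    subst hl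
    exact All.sg (by simp)
  | succ m ih =>
    intro l D hD hl hM hd
    have hne : l ≠ [] := by rintro rfl; simp at hl
    have hX : All (fun t => t.length = m ∧
      (∀ C : Set V, Convex ℝ C → (∀ v ∈ l, v ∈ C) → ∀ v ∈ t, v ∈ C) ∧
      ∀ v ∈ t, ∀ w ∈ t, dist v w ≤ (1 - 1 / (M : ℝ)) * D) (ext (sdF m) (bd0 l)) := by
      apply All.ext
      intro l' hl'
      obtain ⟨h1, h2⟩ := All.bd0 l l' hl'
      refine (ih l' D hD (by omega) (by omega)
        (fun v hv w hw => hd v (h2 v hv) w (h2 w hw))).mono ?_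
      rintro t ⟨a, b, c⟩
      exact ⟨a, fun C hC h => b C hC fun v hv => h v (h2 v hv), c⟩
    refine hX.cone (bary l) ?_
    rintro t ⟨a, b, c⟩
    have hMp : (0 : ℝ) < m + 1 := by positivity
    have hMM : ((m : ℝ) + 1) ≤ M := by exact_mod_cast hM
    have hball : ∀ v ∈ t, dist v (bary l) ≤ (1 - 1 / (M : ℝ)) * D := by
      intro v hv
      have := b (Metric.closedBall (bary l) ((1 - 1 / (l.length : ℝ)) * D))
        (convex_closedBall _ _) (fun v hv => bary_dist hd v hv) v hv
      rw [Metric.mem_closedBall] at this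
      refine this.trans ?_
      rw [hl]
      push_cast
      gcongr
    have hnn : 0 ≤ (1 - 1 / (M : ℝ)) * D := by
      apply mul_nonneg _ hD
      rw [sub_nonneg, div_le_one (by linarith)]
      have : (0 : ℝ) ≤ m := by positivity
      linarith
    refine ⟨by simp [a], ?_, ?_⟩
    · intro C hC h v hv
      rcases List.mem_cons.1 hv with rfl | hv
      · exact bary_mem hne hC h
      · exact b C hC h v hv
    · intro v hv w hw
      rcases List.mem_cons.1 hv with rfl | hv <;> rcases List.mem_cons.1 hw with rfl | hw
      · simpa using hnn
      · rw [dist_comm]; exact hball _ hw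
      · exact hball _ hv
      · exact c v hv w hw

end sd


/-! Borsuk–Ulam -/

/-- face of the cross-polytope with sign vector `s`. -/
def Cs {N : ℕ} (s : Fin (N + 1) → ℝ) : Set (Fin (N + 1) → ℝ) :=
  {v | ∑ i, s i * v i = 1 ∧ ∀ i, 0 ≤ s i * v i}

lemma Cs_convex {N : ℕ} (s : Fin (N + 1) → ℝ) : Convex ℝ (Cs s) := by
  intro v hv w hw a b ha hb hab
  refine ⟨?_, fun i => ?_⟩
  · have : ∑ i, s i * (a • v + b • w) i = a * ∑ i, s i * v i + b * ∑ i, s i * w i := by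
      rw [Finset.mul_sum, Finset.mul_sum, ← Finset.sum_add_distrib]
      refine Finset.sum_congr rfl fun i _ => ?_
      simp
      ring
    rw [this, hv.1, hw.1]
    linarith
  · have h1 := mul_nonneg ha (hv.2 i)
    have h2 := mul_nonneg hb (hw.2 i)
    simp only [Pi.add_apply, Pi.smul_apply, smul_eq_mul]
    linarith

lemma Cs_abs {N : ℕ} {s : Fin (N + 1) → ℝ} (hs : ∀ i, s i = 1 ∨ s i = -1)
    {v : Fin (N + 1) → ℝ} (hv : v ∈ Cs s) : ∑ i, |v i| = 1 := by
  rw [← hv.1]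
  refine Finset.sum_congr rfl fun i _ => ?_
  have h := hv.2 i
  rcases hs i with h1 | h1 <;> rw [h1] at h ⊢
  · rw [abs_of_nonneg (by linarith)]; ring
  · rw [abs_of_nonpos (by linarith)]; ring

structure Good (N : ℕ) (D : ℝ) (c : ℕ → Ch (Fin (N + 1) → ℝ)) : Prop where
  zero : c 0 = sg [Pi.single 0 1]
  bdry : ∀ k, bd (c (k + 1)) = c k + mp (fun v => -v) (c k)
  all : ∀ k ≤ N, All (fun l => l.length = k + 1 ∧
    (∃ s : Fin (N + 1) → ℝ, (∀ i, s i = 1 ∨ s i = -1) ∧ ∀ v ∈ l, v ∈ Cs s) ∧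
    ∀ v ∈ l, ∀ w ∈ l, dist v w ≤ D) (c k)
  len : ∀ k, All (fun l => l.length = k + 1) (c k)

lemma Good.sd {N : ℕ} {D : ℝ} (hD : 0 ≤ D) {c : ℕ → Ch (Fin (N + 1) → ℝ)} (h : Good N D c) :
    Good N ((1 - 1 / ((N + 1 : ℕ) : ℝ)) * D) (fun k => ext (sdF (k + 1)) (c k)) := by
  refine ⟨?_, ?_, ?_, ?_⟩
  · simp [h.zero, sdF, bd0, bary, cone_sg]
  · intro k
    have h1 := ext_congr (f := bd ∘ₗ ext (sdF (k + 2))) (g := ext (sdF (k + 1)) ∘ₗ bd)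
      (c (k + 1)) (by
        intro l hl
        simp only [LinearMap.comp_apply, ext_sg, bd_sg]
        exact bd_sdF (k + 1) l (h.len (k + 1) l hl))
    simp only [LinearMap.comp_apply] at h1
    rw [h1, h.bdry, map_add]
    congr 1
    have h : mp (fun v => -v) ∘ₗ ext (sdF (k + 1)) =
        ext (sdF (k + 1)) ∘ₗ mp (fun v : Fin (N + 1) → ℝ => -v) := by
      apply hom_ext
      intro l
      simp only [LinearMap.comp_apply, ext_sg, mp_sg, sdF_neg]
    exact (LinearMap.congr_fun h _).symm
  · intro k hk
    apply All.ext
    intro l hl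
    obtain ⟨h1, ⟨s, hs, hsl⟩, h3⟩ := h.all k hk l hl
    refine (sdF_all (N + 1) (k + 1) l D hD h1 (by omega) h3).mono ?_
    rintro t ⟨a, b, d⟩
    exact ⟨a, ⟨s, hs, b _ (Cs_convex s) hsl⟩, d⟩
  · intro k
    apply All.ext
    intro l hl
    obtain ⟨D', hD', hd⟩ : ∃ D' : ℝ, 0 ≤ D' ∧ ∀ v ∈ l, ∀ w ∈ l, dist v w ≤ D' := by
      have hfin : ({v | v ∈ l} : Set (Fin (N + 1) → ℝ)).Finite := List.finite_toSet l
      exact ⟨_, Metric.diam_nonneg, fun v hv w hw => Metric.dist_le_diam_of_mem hfin.isBounded hv hw⟩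
    exact (sdF_all (k + 1) (k + 1) l D' hD' (h.len k l hl) le_rfl hd).mono fun t ht => ht.1

def EE (N k : ℕ) : Fin (N + 1) → ℝ := Pi.single (Fin.ofNat (N + 1) k) 1

def HH (N : ℕ) : ℕ → Ch (Fin (N + 1) → ℝ)
  | 0 => sg [Pi.single 0 1]
  | k + 1 => cone (EE N (k + 1)) (HH N k + mp (fun v => -v) (HH N k))

lemma mp_neg_neg {N : ℕ} (c : Ch (Fin (N + 1) → ℝ)) :
    mp (fun v => -v) (mp (fun v => -v) c) = c := by
  have : mp (fun v => -v) ∘ₗ mp (fun v : Fin (N + 1) → ℝ => -v) = LinearMap.id := by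
    apply hom_ext
    intro l
    simp [mp_sg]
  exact LinearMap.congr_fun this c

lemma HH_bd (N k : ℕ) : bd (HH N (k + 1)) = HH N k + mp (fun v => -v) (HH N k) := by
  induction k with
  | zero =>
    have hcone : HH N (0 + 1) = cone (EE N 1) (HH N 0 + mp (fun v => -v) (HH N 0)) := rfl
    rw [hcone, bd_cone]
    have : bd (HH N 0 + mp (fun v => -v) (HH N 0)) = 0 := by
      simp only [HH, mp_sg, map_add, bd_sg, bd0, List.map_cons, List.map_nil, map_zero, add_zero]
      exact two_zero _
    rw [this]; simp
  | succ k ih =>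
    rw [HH, bd_cone]
    have : bd (HH N (k + 1) + mp (fun v => -v) (HH N (k + 1))) = 0 := by
      rw [map_add, ← mp_bd, ih, map_add, mp_neg_neg, add_comm (mp _ _)]
      exact two_zero _
    rw [this]; simp

lemma HH_len (N k : ℕ) : All (fun l => l.length = k + 1) (HH N k) := by
  induction k with
  | zero => exact All.sg rfl
  | succ k ih =>
    rw [HH]
    refine (ih.add (ih.mp _ (Q := fun l => l.length = k + 1) ?_)).cone _ ?_
    · intro l hl; simpa using hl
    · intro l hl; simpa using hl

lemma HH_all (N k : ℕ) (hk : k ≤ N) : All (fun l =>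
    ∃ s : Fin (N + 1) → ℝ, (∀ i, s i = 1 ∨ s i = -1) ∧ ∀ v ∈ l, v ∈ Cs s ∧
      ∀ i : Fin (N + 1), k < i.val → v i = 0) (HH N k) := by
  induction k with
  | zero =>
    refine All.sg ⟨fun _ => 1, fun _ => Or.inl rfl, ?_⟩
    intro v hv
    simp only [List.mem_singleton] at hv
    subst hv
    refine ⟨⟨by simp, fun i => ?_⟩, ?_⟩
    · by_cases h : i = 0
      · subst h; simp
      · simp [h]
    · intro i hi
      have : i ≠ 0 := by rintro rfl; simp at hi
      simp [this]
  | succ k ih =>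
    rw [HH]
    have ih := ih (by omega)
    refine (ih.add (ih.mp _ ?_)).cone _ ?_
    · rintro l ⟨s, hs, h⟩
      refine ⟨-s, fun i => ?_, ?_⟩
      · rcases hs i with h | h <;> simp [h]
      · intro v hv
        obtain ⟨w, hw, rfl⟩ := List.mem_map.1 hv
        obtain ⟨⟨h1, h2⟩, h3⟩ := h w hw
        exact ⟨⟨by simpa using h1, fun i => by simpa using h2 i⟩, fun i hi => by simp [h3 i hi]⟩
    · rintro l ⟨s, hs, h⟩
      have hval : (Fin.ofNat (N + 1) (k + 1)).val = k + 1 := by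
        simp; omega
      set j : Fin (N + 1) := Fin.ofNat (N + 1) (k + 1) with hj
      refine ⟨Function.update s j 1, fun i => ?_, ?_⟩
      · by_cases hi : i = j
        · subst hi; simp
        · simp [hi, hs i]
      · intro v hv
        rcases List.mem_cons.1 hv with rfl | hv
        · rw [EE, ← hj]
          refine ⟨⟨?_, fun i => ?_⟩, fun i hi => ?_⟩
          · rw [Finset.sum_eq_single j]
            · simp
            · intro b _ hb; simp [hb]
            · simp
          · by_cases hi : i = j
            · subst hi; simp
            · simp [hi]
          · have : i ≠ j := by rintro rfl; omega
            simp [this]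
        · obtain ⟨⟨h1, h2⟩, h3⟩ := h v hv
          have h0 : v j = 0 := h3 j (by omega)
          have heq : ∀ i, Function.update s j 1 i * v i = s i * v i := by
            intro i
            by_cases hi : i = j
            · subst hi; simp [h0]
            · simp [hi]
          refine ⟨⟨?_, fun i => ?_⟩, fun i hi => h3 i (by omega)⟩
          · simpa [heq] using h1
          · rw [heq]; exact h2 i

lemma Good.base (N : ℕ) : Good N 2 (HH N) := by
  refine ⟨rfl, HH_bd N, ?_, HH_len N⟩
  intro k hk l hl
  obtain ⟨s, hs, h⟩ := HH_all N k hk l hl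
  refine ⟨HH_len N k l hl, ⟨s, hs, fun v hv => (h v hv).1⟩, ?_⟩
  have hb : ∀ v ∈ l, ∀ i, |v i| ≤ 1 := by
    intro v hv i
    rw [← Cs_abs hs (h v hv).1]
    exact Finset.single_le_sum (f := fun i => |v i|) (fun i _ => abs_nonneg _) (Finset.mem_univ i)
  intro v hv w hw
  rw [dist_pi_le_iff (by norm_num)]
  intro i
  rw [Real.dist_eq]
  have h1 := abs_sub (v i) (w i)
  have h2 := hb v hv i
  have h3 := hb w hw i
  linarith

lemma Good.exists_small (N : ℕ) (δ : ℝ) (hδ : 0 < δ) : ∃ D < δ, ∃ c, Good N D c := by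
  set ρ : ℝ := 1 - 1 / ((N + 1 : ℕ) : ℝ) with hρ
  have h0 : 0 ≤ ρ := by
    rw [hρ, sub_nonneg, div_le_one (by positivity)]
    push_cast
    have : (0 : ℝ) ≤ N := by positivity
    linarith
  have h1 : ρ < 1 := by
    have : (0 : ℝ) < 1 / ((N + 1 : ℕ) : ℝ) := by positivity
    linarith
  have hr : ∀ r : ℕ, ∃ c, Good N (ρ ^ r * 2) c := by
    intro r
    induction r with
    | zero => exact ⟨_, by simpa using Good.base N⟩
    | succ r ih =>
      obtain ⟨c, hc⟩ := ih
      refine ⟨fun k => ext (sdF (k + 1)) (c k), ?_⟩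
      · have := hc.sd (by positivity)
        rwa [← hρ, ← mul_assoc, ← pow_succ'] at this
  obtain ⟨r, hr'⟩ := exists_pow_lt_of_lt_one (show 0 < δ / 2 by positivity) h1
  exact ⟨ρ ^ r * 2, by linarith, hr r⟩

lemma exists_sign (N : ℕ) : ∃ t : (Fin (N + 1) → ℝ) → ZMod 2, ∀ v, v ≠ 0 → t (-v) = t v + 1 := by
  classical
  refine ⟨fun v => if 0 < toLex v then 0 else 1, ?_⟩
  intro v hv
  have hne : toLex v ≠ 0 := by simpa using hv
  have hneg : toLex (-v) = - toLex v := rfl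
  rcases lt_or_gt_of_ne hne with h | h
  · have h' : 0 < toLex (-v) := by rw [hneg]; exact neg_pos.2 h
    have h2 : ¬ 0 < toLex v := not_lt_of_gt h
    simp only
    rw [if_pos h', if_neg h2]; rfl
  · have h' : ¬ 0 < toLex (-v) := by rw [hneg]; exact not_lt_of_gt (neg_lt_zero.2 h)
    have h2 : 0 < toLex v := h
    simp only
    rw [if_neg h', if_pos h2]; rfl

theorem borsuk_ulam (N : ℕ) (f : (Fin (N + 1) → ℝ) → Fin N → ℝ) (hodd : ∀ x, f (-x) = - f x)
    (hf : ContinuousOn f {0}ᶜ) : ∃ x, x ≠ 0 ∧ f x = 0 := by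
  classical
  by_contra! hne
  obtain ⟨t, ht⟩ := exists_sign N
  let K : Set (Fin (N + 1) → ℝ) := {x | ∑ i, |x i| = 1}
  have hK0 : ∀ x ∈ K, x ≠ 0 := by
    rintro x hx rfl
    simp [K] at hx
  have hK : IsCompact K := by
    apply Metric.isCompact_of_isClosed_isBounded
    · exact isClosed_eq (by fun_prop) continuous_const
    · refine (Metric.isBounded_closedBall (x := (0 : Fin (N + 1) → ℝ)) (r := 1)).subset ?_
      intro x hx
      rw [mem_closedBall_zero_iff, pi_norm_le_iff_of_nonneg zero_le_one]
      intro i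
      have hx' : ∑ i, |x i| = 1 := hx
      rw [Real.norm_eq_abs, ← hx']
      exact Finset.single_le_sum (f := fun i => |x i|) (fun i _ => abs_nonneg _) (Finset.mem_univ i)
  let U : Fin N × Bool → Set (Fin (N + 1) → ℝ) := fun p =>
    {0}ᶜ ∩ (fun x => f x p.1) ⁻¹' (if p.2 then Set.Ioi 0 else Set.Iio 0)
  have hU : ∀ p, IsOpen (U p) := by
    intro p
    apply ContinuousOn.isOpen_inter_preimage
    · exact continuousOn_pi.1 hf p.1
    · exact isOpen_compl_singleton
    · split_ifs
      exacts [isOpen_Ioi, isOpen_Iio]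
  obtain ⟨δ, hδ, hδU⟩ := lebesgue_number_lemma_of_metric hK hU (by
    intro x hx
    have h1 := hne x (hK0 x hx)
    obtain ⟨i, hi⟩ := Function.ne_iff.1 h1
    rcases lt_or_gt_of_ne hi with h | h
    · exact Set.mem_iUnion.2 ⟨(i, false), hK0 x hx, by simpa using h⟩
    · exact Set.mem_iUnion.2 ⟨(i, true), hK0 x hx, by simpa using h⟩)
  obtain ⟨D, hD, c, hc⟩ := Good.exists_small N δ hδ
  let u : Fin N → (Fin (N + 1) → ℝ) → ZMod 2 := fun i v =>
    if 0 < f v i then 0 else if f v i < 0 then 1 else t v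
  have hu : ∀ i v, v ≠ 0 → u i (-v) = u i v + 1 := by
    intro i v hv
    simp only [u, hodd, Pi.neg_apply, neg_pos, neg_lt_zero]
    rcases lt_trichotomy (f v i) 0 with h | h | h
    · simp only [h, not_lt_of_gt h, if_true, if_false]; rfl
    · simp only [h, lt_irrefl, if_false]; exact ht v hv
    · simp only [h, not_lt_of_gt h, if_true, if_false]; rfl
  have hKl : ∀ k ≤ N, ∀ l ∈ (c k).support, ∀ v ∈ l, v ∈ K := by
    intro k hk l hl v hv
    obtain ⟨-, ⟨s, hs, h⟩, -⟩ := hc.all k hk l hl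
    exact Cs_abs hs (h v hv)
  have h1 := pairing (fun v => -v) c _ hc.zero N (fun k _ => hc.bdry k) (List.ofFn u) (by simp) (by
    intro u' hu' k hk l hl v hv
    obtain ⟨i, rfl⟩ := (List.mem_ofFn' _ _).1 hu'
    exact hu i v (hK0 v (hKl k hk.le l hl v hv)))
  rw [List.length_ofFn] at h1
  have h2 := ext_congr (f := ext (phi (List.ofFn u))) (g := 0) (c N) (by
    intro l hl
    rw [ext_sg, LinearMap.zero_apply]
    obtain ⟨hlen, -, hdist⟩ := hc.all N le_rfl l hl
    obtain ⟨x, hx⟩ : ∃ x, x ∈ l := List.exists_mem_of_length_pos (by omega)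
    obtain ⟨⟨i, b⟩, hp⟩ := hδU x (hKl N le_rfl l hl x hx)
    have hmem : ∀ v ∈ l, v ∈ U (i, b) := fun v hv => hp (by
      rw [Metric.mem_ball]; exact (hdist v hv x hx).trans_lt hD)
    have hcon : ∀ v ∈ l, u i v = if b then 0 else 1 := by
      intro v hv
      have h := (hmem v hv).2
      cases b
      · have h : f v i < 0 := by simpa using h
        simp [u, h, not_lt_of_gt h]
      · have h : 0 < f v i := by simpa using h
        simp [u, h]
    refine phi_const _ l (u i) ((List.mem_ofFn' _ _).2 ⟨i, rfl⟩) ?_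
    intro v hv w hw
    rw [hcon v hv, hcon w hw])
  rw [h2] at h1
  simp at h1

end
end HamSandwich

open HamSandwich

theorem polyFam (n N : ℕ) : ∃ m : Fin (N + 1) → (Fin (n + 1) →₀ ℕ), Function.Injective m ∧
    ∀ i, (((m i).sum fun _ e => e : ℕ) : ℝ) ≤ ((n : ℝ) + 1) * (N : ℝ) ^ ((1 : ℝ) / (n + 1)) := by
  set k := ⌊(N : ℝ) ^ ((1 : ℝ) / (n + 1))⌋₊ with hk
  have hcard : N + 1 ≤ Fintype.card (Fin (n + 1) → Fin (k + 1)) := by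
    simp only [Fintype.card_fun, Fintype.card_fin]
    have h1 : (N : ℝ) ^ ((1 : ℝ) / (n + 1)) < k + 1 := Nat.lt_floor_add_one _
    have h2 : ((N : ℝ) ^ ((1 : ℝ) / (n + 1))) ^ (n + 1) < ((k : ℝ) + 1) ^ (n + 1) :=
      pow_lt_pow_left₀ h1 (by positivity) (by omega)
    have h3 : ((N : ℝ) ^ ((1 : ℝ) / (n + 1))) ^ (n + 1) = N := by
      rw [one_div]
      have := Real.rpow_inv_natCast_pow (x := (N : ℝ)) (n := n + 1) (by positivity) (by omega)
      exact_mod_cast this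
    rw [h3] at h2
    exact_mod_cast h2
  obtain ⟨g⟩ : Nonempty (Fin (N + 1) ↪ (Fin (n + 1) → Fin (k + 1))) := by
    apply Function.Embedding.nonempty_of_card_le
    simpa using hcard
  refine ⟨fun i => Finsupp.equivFunOnFinite.symm fun j => (g i j : ℕ), ?_, ?_⟩
  · intro a b hab
    apply g.injective
    funext j
    have := DFunLike.congr_fun hab j
    simpa [Fin.ext_iff] using this
  · intro i
    rw [Finsupp.sum_fintype _ _ (by simp)]
    have h1 : ∑ j, ((g i j : ℕ)) ≤ (n + 1) * k := by
      refine (Finset.sum_le_card_nsmul Finset.univ _ k fun j _ => ?_).trans (by simp)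
      have := (g i j).isLt
      omega
    have h2 : (k : ℝ) ≤ (N : ℝ) ^ ((1 : ℝ) / (n + 1)) := Nat.floor_le (by positivity)
    calc _ ≤ (((n + 1) * k : ℕ) : ℝ) := by
            simp only [Finsupp.equivFunOnFinite_symm_apply_apply]
            exact_mod_cast h1
      _ = ((n : ℝ) + 1) * k := by push_cast; ring
      _ ≤ _ := by gcongr

theorem continuousAt_sign_real (a : ℝ) (ha : a ≠ 0) :
    ContinuousAt (fun x : ℝ => ((SignType.sign x : SignType) : ℝ)) a := by
  rcases lt_or_gt_of_ne ha with h | h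
  · apply (continuousAt_const (y := (-1 : ℝ))).congr
    filter_upwards [gt_mem_nhds h] with x hx
    simp [sign_neg hx]
  · apply (continuousAt_const (y := (1 : ℝ))).congr
    filter_upwards [lt_mem_nhds h] with x hx
    simp [sign_pos hx]

theorem stmt2 (n : ℕ) :
    ∃ c : ℝ, 0 < c ∧
      ∀ (N : ℕ) (μ : Fin N → Measure (Fin (n + 1) → ℝ)),
        (∀ j, IsFiniteMeasure (μ j)) →
        (∀ j (Q : MvPolynomial (Fin (n + 1)) ℝ), Q ≠ 0 →
          (Q.totalDegree : ℝ) ≤ c * (N : ℝ) ^ ((1 : ℝ) / (n + 1)) →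
          μ j {z | MvPolynomial.eval z Q = 0} = 0) →
        ∃ P : MvPolynomial (Fin (n + 1)) ℝ, P ≠ 0 ∧
          (P.totalDegree : ℝ) ≤ c * (N : ℝ) ^ ((1 : ℝ) / (n + 1)) ∧
          ∀ j, μ j {z | 0 < MvPolynomial.eval z P} = μ j {z | MvPolynomial.eval z P < 0} := by
  refine ⟨(n : ℝ) + 1, by positivity, ?_⟩
  intro N μ hfin hμ
  obtain ⟨m, hinj, hdeg⟩ := polyFam n N
  let P : (Fin (N + 1) → ℝ) → MvPolynomial (Fin (n + 1)) ℝ := fun x =>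
    ∑ i, MvPolynomial.monomial (m i) (x i)
  have hPcoeff : ∀ x i, (P x).coeff (m i) = x i := by
    intro x i
    simp only [P, MvPolynomial.coeff_sum, MvPolynomial.coeff_monomial]
    rw [Finset.sum_eq_single i]
    · simp
    · intro b _ hb
      simp [hinj.ne hb]
    · simp
  have hP0 : ∀ x, x ≠ 0 → P x ≠ 0 := by
    intro x hx h
    apply hx
    funext i
    rw [← hPcoeff x i, h]; simp
  have hPdeg : ∀ x, ((P x).totalDegree : ℝ) ≤ ((n : ℝ) + 1) * (N : ℝ) ^ ((1 : ℝ) / (n + 1)) := by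
    intro x
    have h1 : (P x).totalDegree ≤ ⌊((n : ℝ) + 1) * (N : ℝ) ^ ((1 : ℝ) / (n + 1))⌋₊ := by
      apply MvPolynomial.totalDegree_finsetSum_le
      intro i _
      exact (MvPolynomial.totalDegree_monomial_le _ _).trans (Nat.le_floor (hdeg i))
    exact (Nat.cast_le.2 h1).trans (Nat.floor_le (by positivity))
  have hPneg : ∀ x, P (-x) = - P x := by
    intro x
    simp [P]
  have hPev : ∀ x z, MvPolynomial.eval z (P x) =
      ∑ i, x i * (m i).prod (fun j e => z j ^ e) := by
    intro x z
    simp [P, MvPolynomial.eval_monomial]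
  have hcontz : ∀ Q : MvPolynomial (Fin (n + 1)) ℝ, Measurable fun z => MvPolynomial.eval z Q :=
    fun Q => (MvPolynomial.continuous_eval Q).measurable
  have hsm : ∀ Q : MvPolynomial (Fin (n + 1)) ℝ,
      Measurable fun z => ((SignType.sign (MvPolynomial.eval z Q) : SignType) : ℝ) := by
    intro Q
    have h1 : (fun z => ((SignType.sign (MvPolynomial.eval z Q) : SignType) : ℝ)) = fun z =>
        Set.indicator {z | 0 < MvPolynomial.eval z Q} (fun _ => (1 : ℝ)) z -
        Set.indicator {z | MvPolynomial.eval z Q < 0} (fun _ => (1 : ℝ)) z := by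
      funext z
      rcases lt_trichotomy (MvPolynomial.eval z Q) 0 with h | h | h
      · simp [h, not_lt_of_gt h, Set.indicator]
      · simp [h, Set.indicator]
      · simp [h, not_lt_of_gt h, Set.indicator]
    rw [h1]
    exact (measurable_const.indicator (measurableSet_lt measurable_const (hcontz Q))).sub
      (measurable_const.indicator (measurableSet_lt (hcontz Q) measurable_const))
  let f : (Fin (N + 1) → ℝ) → Fin N → ℝ := fun x j =>
    ∫ z, ((SignType.sign (MvPolynomial.eval z (P x)) : SignType) : ℝ) ∂(μ j)
  have hodd : ∀ x, f (-x) = - f x := by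
    intro x
    funext j
    simp only [f, hPneg, map_neg, Pi.neg_apply]
    rw [← integral_neg]
    congr 1
    funext z
    rw [Left.sign_neg]
    simp
  have hf : ContinuousOn f {0}ᶜ := by
    intro x hx
    apply ContinuousAt.continuousWithinAt
    rw [continuousAt_pi]
    intro j
    have := hfin j
    apply continuousAt_of_dominated (bound := fun _ => (1 : ℝ))
    · exact Filter.Eventually.of_forall fun y => (hsm (P y)).aestronglyMeasurable
    · refine Filter.Eventually.of_forall fun y => Filter.Eventually.of_forall fun z => ?_
      rcases lt_trichotomy (MvPolynomial.eval z (P y)) 0 with h | h | h <;> simp [h]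
    · exact integrable_const _
    · have h0 := hμ j (P x) (hP0 x hx) (hPdeg x)
      have : ∀ᵐ z ∂(μ j), MvPolynomial.eval z (P x) ≠ 0 := by
        rw [ae_iff]; simpa using h0
      filter_upwards [this] with z hz
      refine ContinuousAt.comp (f := fun x => MvPolynomial.eval z (P x))
        (g := fun x : ℝ => ((SignType.sign x : SignType) : ℝ)) (continuousAt_sign_real _ hz) ?_
      simp only [hPev]
      refine Continuous.continuousAt ?_
      exact continuous_finsetSum _ fun i _ => (continuous_apply i).mul continuous_const
  obtain ⟨x, hx, hfx⟩ := borsuk_ulam N f hodd hf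
  refine ⟨P x, hP0 x hx, hPdeg x, fun j => ?_⟩
  have := hfin j
  have h0 : f x j = 0 := by rw [hfx]; rfl
  have hm1 : MeasurableSet {z | 0 < MvPolynomial.eval z (P x)} :=
    measurableSet_lt measurable_const (hcontz _)
  have hm2 : MeasurableSet {z | MvPolynomial.eval z (P x) < 0} :=
    measurableSet_lt (hcontz _) measurable_const
  have h1 : (fun z => ((SignType.sign (MvPolynomial.eval z (P x)) : SignType) : ℝ)) = fun z =>
      Set.indicator {z | 0 < MvPolynomial.eval z (P x)} (fun _ => (1 : ℝ)) z -
      Set.indicator {z | MvPolynomial.eval z (P x) < 0} (fun _ => (1 : ℝ)) z := by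
    funext z
    rcases lt_trichotomy (MvPolynomial.eval z (P x)) 0 with h | h | h
    · simp [h, not_lt_of_gt h, Set.indicator]
    · simp [h, Set.indicator]
    · simp [h, not_lt_of_gt h, Set.indicator]
  simp only [f] at h0
  rw [h1, integral_sub ((integrable_const _).indicator hm1) ((integrable_const _).indicator hm2),
    integral_indicator_const _ hm1, integral_indicator_const _ hm2] at h0
  simp only [smul_eq_mul, mul_one, sub_eq_zero] at h0
  exact (measureReal_eq_measureReal_iff).1 h0
end

section
/- Let μ be a finite Borel measure on ℝ^(n+1) that gives zero mass to the zero set of every nonzero polynomial. Then for each D ≥ 1 there is a nonzero polynomial P of degree at most D such that ℝ^(n+1) \ Z(P) is a union of ~_n D^(n+1) disjoint open sets O_i, and for each i one has μ(ℝ^(n+1)) ≤ c_n D^(n+1) μ(O_i). -/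
open MeasureTheory

lemma pp_exists_root_odd (p : Polynomial ℝ) (hm : p.Monic) (h : Odd p.natDegree) :
    ∃ x, p.IsRoot x := by
  have hd : 0 < p.degree := by
    rw [← Polynomial.natDegree_pos_iff_degree_pos]; exact h.pos
  have h1 := Polynomial.tendsto_atTop_of_leadingCoeff_nonneg p hd (by rw [hm]; norm_num)
  set q : Polynomial ℝ := -(p.comp (-Polynomial.X)) with hq
  have hqn : q.natDegree = p.natDegree := by
    rw [hq, Polynomial.natDegree_neg, Polynomial.natDegree_comp]; simp
  have hql : q.leadingCoeff = 1 := by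
    rw [hq, Polynomial.leadingCoeff_neg, Polynomial.leadingCoeff_comp (by simp)]
    simp [hm.leadingCoeff, h.neg_one_pow]
  have hqd : 0 < q.degree := by
    rw [← Polynomial.natDegree_pos_iff_degree_pos, hqn]; exact h.pos
  have h2 := Polynomial.tendsto_atTop_of_leadingCoeff_nonneg q hqd (by rw [hql]; norm_num)
  obtain ⟨a, ha⟩ := (h1.eventually_ge_atTop 0).exists
  obtain ⟨b, hb⟩ := (h2.eventually_ge_atTop 0).exists
  have hb' : p.eval (-b) ≤ 0 := by
    simp [hq, Polynomial.eval_comp] at hb; exact hb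
  obtain ⟨x, hx⟩ := mem_range_of_exists_le_of_exists_ge p.continuous ⟨-b, hb'⟩ ⟨a, ha⟩
  exact ⟨x, hx⟩

lemma pp_exists_eigen_odd {V : Type*} [AddCommGroup V] [Module ℝ V] [FiniteDimensional ℝ V]
    (h : Odd (Module.finrank ℝ V)) (T : Module.End ℝ V) :
    ∃ (a : ℝ) (v : V), v ≠ 0 ∧ T v = a • v := by
  obtain ⟨a, ha⟩ := pp_exists_root_odd (LinearMap.charpoly T) (LinearMap.charpoly_monic T)
    (by rwa [LinearMap.charpoly_natDegree])
  rw [← Module.End.hasEigenvalue_iff_isRoot_charpoly] at ha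
  obtain ⟨v, hv⟩ := ha.exists_hasEigenvector
  exact ⟨a, v, hv.2, hv.apply_eq_smul⟩

lemma pp_common_eigen_aux {ι V : Type*} [AddCommGroup V] [Module ℝ V] [FiniteDimensional ℝ V]
    (T : ι → Module.End ℝ V) (hc : ∀ i j v, T i (T j v) = T j (T i v)) (N : ℕ) :
    ∀ W : Submodule ℝ V, Module.finrank ℝ W = N → Odd N → (∀ i, ∀ v ∈ W, T i v ∈ W) →
    ∃ (v : V) (a : ι → ℝ), v ≠ 0 ∧ ∀ i, T i v = a i • v := by
  induction N using Nat.strong_induction_on with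
  | _ N ih =>
  intro W hW hN hinv
  have hex : ∀ i, ∃ (a : ℝ) (v : W), v ≠ 0 ∧ (T i).restrict (hinv i) v = a • v := fun i =>
    pp_exists_eigen_odd (hW ▸ hN) _
  choose a w hw0 hw using hex
  have hw' : ∀ i, T i (w i : V) = a i • (w i : V) := fun i => by
    have := congrArg Subtype.val (hw i)
    simpa using this
  by_cases hall : ∀ i, ∀ v ∈ W, T i v = a i • v
  · have : Nontrivial W := Module.nontrivial_of_finrank_pos (R := ℝ) (by rw [hW]; exact hN.pos)
    obtain ⟨v, hv⟩ := exists_ne (0 : W)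
    exact ⟨v, a, by simpa using hv, fun i => hall i v v.2⟩
  · push Not at hall
    obtain ⟨i, u, huW, hu⟩ := hall
    let S : Module.End ℝ V := T i - a i • LinearMap.id
    have hS : ∀ v, S v = T i v - a i • v := fun v => by simp [S]
    have hScomm : ∀ j v, T j (S v) = S (T j v) := fun j v => by
      simp [hS, hc j i]
    let g : W →ₗ[ℝ] V := S.domRestrict W
    have hrn := LinearMap.finrank_range_add_finrank_ker g
    rw [hW] at hrn
    have hker : Module.finrank ℝ (g.ker.map W.subtype) = Module.finrank ℝ g.ker :=
      (Submodule.equivMapOfInjective W.subtype W.injective_subtype g.ker).finrank_eq.symm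
    have hrpos : 0 < Module.finrank ℝ g.range := by
      rw [Module.finrank_pos_iff_exists_ne_zero]
      refine ⟨⟨g ⟨u, huW⟩, LinearMap.mem_range_self _ _⟩, ?_⟩
      simpa [g, hS, Subtype.ext_iff, sub_eq_zero] using hu
    have hkpos : 0 < Module.finrank ℝ g.ker := by
      rw [Module.finrank_pos_iff_exists_ne_zero]
      refine ⟨⟨w i, ?_⟩, ?_⟩
      · rw [LinearMap.mem_ker]
        change S (w i : V) = 0
        rw [hS, hw', sub_self]
      · intro h
        exact hw0 i (congrArg Subtype.val h)
    rcases Nat.even_or_odd (Module.finrank ℝ g.range) with he | ho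
    · refine ih _ ?_ (g.ker.map W.subtype) hker ?_ ?_
      · omega
      · rw [← hrn] at hN
        rcases Nat.even_or_odd (Module.finrank ℝ g.ker) with h1 | h1
        · exact absurd hN (by simpa using he.add h1)
        · exact h1
      · rintro j v ⟨x, hx, rfl⟩
        refine ⟨⟨T j x, hinv j x x.2⟩, ?_, rfl⟩
        have hx' : S x = 0 := hx
        change S (T j x) = 0
        rw [← hScomm, hx', map_zero]
    · refine ih _ ?_ g.range rfl ho ?_
      · omega
      · rintro j v ⟨x, rfl⟩
        exact ⟨⟨T j x, hinv j x x.2⟩, (hScomm j x).symm⟩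

lemma pp_common_eigen {ι V : Type*} [AddCommGroup V] [Module ℝ V] [FiniteDimensional ℝ V]
    (T : ι → Module.End ℝ V) (hc : ∀ i j v, T i (T j v) = T j (T i v))
    (hodd : Odd (Module.finrank ℝ V)) :
    ∃ (v : V) (a : ι → ℝ), v ≠ 0 ∧ ∀ i, T i v = a i • v :=
  pp_common_eigen_aux T hc _ ⊤ (finrank_top ℝ V) hodd (fun _ _ _ => trivial)

section partB
open MvPolynomial

noncomputable def ppB {n : ℕ} {R : Type*} [CommRing R] (d : ℕ) (F : Fin n → MvPolynomial (Fin n) R)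
    (e : Fin n →₀ ℕ) : MvPolynomial (Fin n) R :=
  ∏ i, (X i ^ (e i % d) * F i ^ (e i / d))

lemma ppB_map {n : ℕ} {R S : Type*} [CommRing R] [CommRing S] (φ : R →+* S) (d : ℕ)
    (F : Fin n → MvPolynomial (Fin n) R) (e : Fin n →₀ ℕ) :
    map φ (ppB d F e) = ppB d (fun i => map φ (F i)) e := by
  simp [ppB, map_prod]

lemma ppB_X {n : ℕ} {R : Type*} [CommRing R] (d : ℕ) (e : Fin n →₀ ℕ) :
    ppB (R := R) d (fun i => X i ^ d) e = monomial e 1 := by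
  rw [monomial_eq, Finsupp.prod_fintype _ _ (by simp)]
  simp only [ppB, C_1, one_mul]
  refine Finset.prod_congr rfl fun i _ => ?_
  rw [← pow_mul, ← pow_add, Nat.mod_add_div]

lemma ppB_totalDegree {n : ℕ} (d : ℕ) (F : Fin n → MvPolynomial (Fin n) ℝ)
    (hF : ∀ i, (F i).totalDegree ≤ d) (e : Fin n →₀ ℕ) :
    (ppB d F e).totalDegree ≤ e.degree := by
  rw [Finsupp.degree_eq_sum]
  refine (totalDegree_finsetProd _ _).trans (Finset.sum_le_sum fun i _ => ?_)
  refine (totalDegree_mul _ _).trans ?_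
  rw [totalDegree_X_pow]
  have h1 := (totalDegree_pow (F i) (e i / d)).trans (Nat.mul_le_mul_left _ (hF i))
  have h2 := Nat.mod_add_div (e i) d
  rw [mul_comm] at h1
  omega

lemma ppB_mul {n : ℕ} {R : Type*} [CommRing R] {d : ℕ} (hd : 0 < d)
    (F : Fin n → MvPolynomial (Fin n) R) (e : Fin n →₀ ℕ) (i : Fin n) :
    ppB d F e * F i = ppB d F (e + Finsupp.single i d) := by
  unfold ppB
  rw [← Finset.mul_prod_erase Finset.univ _ (Finset.mem_univ i),
    ← Finset.mul_prod_erase Finset.univ (fun j => X j ^ ((e + Finsupp.single i d) j % d) *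
      F j ^ ((e + Finsupp.single i d) j / d)) (Finset.mem_univ i)]
  have h : ∏ j ∈ Finset.univ.erase i, X j ^ ((e + Finsupp.single i d) j % d) *
      F j ^ ((e + Finsupp.single i d) j / d) =
      ∏ j ∈ Finset.univ.erase i, X j ^ (e j % d) * F j ^ (e j / d) := by
    refine Finset.prod_congr rfl fun j hj => ?_
    have : i ≠ j := (Finset.ne_of_mem_erase hj).symm
    simp [this]
  rw [h]
  simp [Nat.add_div_right _ hd]
  ring

lemma ppB_dvd {n : ℕ} {R : Type*} [CommRing R] {d : ℕ} (hd : 0 < d)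
    (F : Fin n → MvPolynomial (Fin n) R) (e : Fin n →₀ ℕ) (i : Fin n) (h : d ≤ e i) :
    F i ∣ ppB d F e := by
  refine dvd_trans ?_ (Finset.dvd_prod_of_mem _ (Finset.mem_univ i))
  exact dvd_mul_of_dvd_right (dvd_pow_self _ (Nat.div_pos h hd).ne') _

lemma pp_degree_le {n : ℕ} {p : MvPolynomial (Fin n) ℝ} {k : ℕ} (hp : p.totalDegree ≤ k)
    {e : Fin n →₀ ℕ} (h : coeff e p ≠ 0) : e.degree ≤ k := by
  refine le_trans ?_ hp
  exact le_totalDegree (mem_support_iff.mpr h)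

noncomputable def ppIdx (n k : ℕ) : Finset (Fin n →₀ ℕ) :=
  (Finsupp.finite_of_degree_le (σ := Fin n) k).toFinset

lemma mem_ppIdx {n k : ℕ} {e : Fin n →₀ ℕ} : e ∈ ppIdx n k ↔ e.degree ≤ k := by
  simp [ppIdx]

noncomputable def ppM {n : ℕ} {R : Type*} [CommRing R] (d : ℕ) (F : Fin n → MvPolynomial (Fin n) R)
    (k : ℕ) : Matrix (ppIdx n k) (ppIdx n k) R :=
  Matrix.of fun e e' => coeff e.1 (ppB d F e'.1)

lemma ppM_map {n : ℕ} {R S : Type*} [CommRing R] [CommRing S] (φ : R →+* S) (d : ℕ)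
    (F : Fin n → MvPolynomial (Fin n) R) (k : ℕ) :
    φ (ppM d F k).det = (ppM d (fun i => map φ (F i)) k).det := by
  rw [RingHom.map_det]
  congr 1
  ext e e'
  simp [ppM, ← ppB_map, coeff_map]

noncomputable def ppF {n : ℕ} (d : ℕ) (f : Fin n → MvPolynomial (Fin n) ℝ) (s : ℝ) (i : Fin n) :
    MvPolynomial (Fin n) ℝ := X i ^ d + C s * f i

lemma pp_good_k {n : ℕ} (d : ℕ) (f : Fin n → MvPolynomial (Fin n) ℝ) (k : ℕ) :
    {s : ℝ | (ppM d (ppF d f s) k).det = 0}.Finite := by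
  let G : Fin n → MvPolynomial (Fin n) (Polynomial ℝ) := fun i =>
    X i ^ d + C Polynomial.X * map Polynomial.C (f i)
  have hG : ∀ s : ℝ, (fun i => map (Polynomial.evalRingHom s) (G i)) = ppF d f s := by
    intro s
    funext i
    have : (Polynomial.evalRingHom s).comp Polynomial.C = RingHom.id ℝ := by ext; simp
    simp [G, ppF, MvPolynomial.map_map, this, MvPolynomial.map_id]
  have hdet : ∀ s : ℝ, (ppM d G k).det.eval s = (ppM d (ppF d f s) k).det := fun s => by
    rw [← hG, ← ppM_map]; rfl
  have h0 : (ppM d (ppF d f 0) k).det = 1 := by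
    have : ppM d (ppF d f 0) k = 1 := by
      have h1 : ppF d f 0 = fun i => X i ^ d := by funext i; simp [ppF]
      ext e e'
      rw [h1]
      simp only [ppM, ppB_X, coeff_monomial, Matrix.one_apply, Subtype.ext_iff, Matrix.of_apply]
      exact if_congr eq_comm rfl rfl
    rw [this, Matrix.det_one]
  have hne : (ppM d G k).det ≠ 0 := by
    intro h
    have := hdet 0
    rw [h, h0] at this
    simp at this
  refine (Polynomial.finite_setOfPred_isRoot hne).subset fun s hs => ?_
  simp only [Set.mem_ofPred_eq] at hs ⊢
  rw [Polynomial.IsRoot, hdet, hs]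

noncomputable def ppT {n : ℕ} (d : ℕ) (F : Fin n → MvPolynomial (Fin n) ℝ) :
    MvPolynomial (Fin n) ℝ →ₗ[ℝ] MvPolynomial (Fin n) ℝ :=
  (basisMonomials (Fin n) ℝ).constr ℝ (ppB d F)

lemma ppT_monomial {n : ℕ} (d : ℕ) (F : Fin n → MvPolynomial (Fin n) ℝ) (e : Fin n →₀ ℕ) (c : ℝ) :
    ppT d F (monomial e c) = c • ppB d F e := by
  have h : (monomial e c : MvPolynomial (Fin n) ℝ) = c • basisMonomials (Fin n) ℝ e := by
    simp [smul_monomial]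
  rw [h, map_smul, ppT, Module.Basis.constr_basis]

lemma ppT_apply {n : ℕ} (d : ℕ) (F : Fin n → MvPolynomial (Fin n) ℝ) (p : MvPolynomial (Fin n) ℝ)
    {k : ℕ} (hp : p.totalDegree ≤ k) :
    ppT d F p = ∑ e : ppIdx n k, coeff e.1 p • ppB d F e.1 := by
  conv_lhs => rw [p.as_sum]
  rw [map_sum, Finset.sum_coe_sort (ppIdx n k) (fun e => coeff e p • ppB d F e)]
  simp only [ppT_monomial]
  refine Finset.sum_subset ?_ ?_
  · intro e he
    exact mem_ppIdx.mpr (pp_degree_le hp (mem_support_iff.mp he))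
  · intro e _ he
    simp [notMem_support_iff.mp he]

lemma ppT_bij {n : ℕ} (d : ℕ) (F : Fin n → MvPolynomial (Fin n) ℝ)
    (hF : ∀ i, (F i).totalDegree ≤ d) (hgood : ∀ k, (ppM d F k).det ≠ 0) :
    Function.Bijective (ppT d F) := by
  have key : ∀ (k : ℕ) (v : ppIdx n k → ℝ) (e : ppIdx n k),
      coeff e.1 (∑ e' : ppIdx n k, v e' • ppB d F e'.1) = (ppM d F k).mulVec v e := by
    intro k v e
    simp [coeff_sum, ppM, Matrix.mulVec, dotProduct, mul_comm]
  constructor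
  · rw [← LinearMap.ker_eq_bot, LinearMap.ker_eq_bot']
    intro p hp
    rw [ppT_apply d F p le_rfl] at hp
    have : (ppM d F p.totalDegree).mulVec (fun e => coeff e.1 p) = 0 := by
      funext e
      rw [← key, hp]; simp
    have := Matrix.eq_zero_of_mulVec_eq_zero (hgood _) this
    ext e
    by_contra h
    exact h (congrFun this ⟨e, mem_ppIdx.mpr (pp_degree_le le_rfl h)⟩)
  · intro q
    set k := q.totalDegree with hk
    have hu : IsUnit (ppM d F k) := by
      rw [Matrix.isUnit_iff_isUnit_det]; exact (hgood k).isUnit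
    obtain ⟨v, hv⟩ := Matrix.mulVec_surjective_iff_isUnit.mpr hu (fun e => coeff e.1 q)
    refine ⟨∑ e, monomial e.1 (v e), ?_⟩
    simp only [map_sum, ppT_monomial]
    have hdeg : (∑ e : ppIdx n k, v e • ppB d F e.1).totalDegree ≤ k := by
      refine totalDegree_finsetSum_le fun e _ => ?_
      exact (totalDegree_smul_le _ _).trans ((ppB_totalDegree d F hF _).trans (mem_ppIdx.mp e.2))
    ext e
    by_cases he : e.degree ≤ k
    · have := key k v ⟨e, mem_ppIdx.mpr he⟩
      rw [hv] at this
      exact this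
    · have h1 : coeff e q = 0 := by
        by_contra h; exact he (pp_degree_le hk.ge h)
      rw [h1]
      by_contra h; exact he (pp_degree_le hdeg h)

noncomputable def ppBox (n d : ℕ) : (Fin n → Fin d) → (Fin n →₀ ℕ) :=
  fun a => Finsupp.equivFunOnFinite.symm (fun i => (a i : ℕ))

lemma ppBox_inj (n d : ℕ) : Function.Injective (ppBox n d) := by
  intro a b h
  funext i
  have := DFunLike.congr_fun h i
  exact Fin.ext this

/-- coefficients in the box, as a linear map -/
noncomputable def ppRes (n d : ℕ) : MvPolynomial (Fin n) ℝ →ₗ[ℝ] ((Fin n → Fin d) → ℝ) :=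
  LinearMap.pi fun a => lcoeff ℝ (ppBox n d a)

lemma ppRes_surj (n d : ℕ) : Function.Surjective (ppRes n d) := by
  intro v
  refine ⟨∑ a, monomial (ppBox n d a) (v a), ?_⟩
  funext b
  simp [ppRes, coeff_monomial, (ppBox_inj n d).eq_iff]

lemma pp_common_zero {n d : ℕ} (hd : Odd d) (F : Fin n → MvPolynomial (Fin n) ℝ)
    (hF : ∀ i, (F i).totalDegree ≤ d) (hgood : ∀ k, (ppM d F k).det ≠ 0) :
    ∃ z : Fin n → ℝ, ∀ i, eval z (F i) = 0 := by
  let T := LinearEquiv.ofBijective (ppT d F) (ppT_bij d F hF hgood)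
  have hT : ∀ p, T p = ppT d F p := fun p => rfl
  let φ : MvPolynomial (Fin n) ℝ →ₗ[ℝ] ((Fin n → Fin d) → ℝ) := (ppRes n d).comp T.symm.toLinearMap
  have hφ : Function.Surjective φ := (ppRes_surj n d).comp T.symm.surjective
  let I : Ideal (MvPolynomial (Fin n) ℝ) := Ideal.span (Set.range F)
  have hker1 : ∀ q ∈ I, φ q = 0 := by
    intro q hq
    refine Submodule.span_induction (p := fun q _ => ∀ r, φ (r * q) = 0) ?_ ?_ ?_ ?_ hq 1
        |> fun h => by simpa using h
    · rintro _ ⟨i, rfl⟩ r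
      obtain ⟨p, rfl⟩ := T.surjective r
      induction p using MvPolynomial.induction_on' with
      | monomial e c =>
        have : T (monomial e c) * F i = T (monomial (e + Finsupp.single i d) c) := by
          rw [hT, hT, ppT_monomial, ppT_monomial, smul_mul_assoc, ppB_mul hd.pos]
        rw [this]
        funext a
        simp only [φ, LinearMap.comp_apply, LinearEquiv.coe_coe, LinearEquiv.symm_apply_apply]
        simp only [ppRes, LinearMap.pi_apply, lcoeff_apply, coeff_monomial, Pi.zero_apply]
        rw [if_neg]
        intro h
        have := DFunLike.congr_fun h i
        have h2 : ppBox n d a i = a i := rfl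
        have h3 := (a i).2
        simp [h2] at this
        omega
      | add p q hp hq =>
        rw [map_add, add_mul, map_add, hp, hq, add_zero]
    · simp
    · intro x y _ _ hx hy r
      rw [mul_add, map_add, hx, hy, add_zero]
    · intro a x _ hx r
      rw [smul_eq_mul, ← mul_assoc]; exact hx _
  have hker2 : ∀ q, φ q = 0 → q ∈ I := by
    intro q hq
    obtain ⟨p, rfl⟩ := T.surjective q
    have hp : ∀ a, coeff (ppBox n d a) p = 0 := fun a => by
      have := congrFun hq a
      simpa [φ, ppRes] using this
    rw [p.as_sum, map_sum]
    refine I.sum_mem fun e he => ?_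
    rw [hT, ppT_monomial, smul_eq_C_mul]
    refine I.mul_mem_left _ ?_
    by_cases hbox : ∀ i, e i < d
    · exfalso
      refine mem_support_iff.mp he ?_
      have : e = ppBox n d (fun i => ⟨e i, hbox i⟩) := by ext i; rfl
      rw [this]; exact hp _
    · push Not at hbox
      obtain ⟨i, hi⟩ := hbox
      obtain ⟨r, hr⟩ := ppB_dvd hd.pos F e i hi
      rw [hr]
      exact I.mul_mem_right _ (Ideal.subset_span ⟨i, rfl⟩)
  let A := MvPolynomial (Fin n) ℝ ⧸ I
  let π : MvPolynomial (Fin n) ℝ →ₗ[ℝ] A := (Ideal.Quotient.mkₐ ℝ I).toLinearMap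
  have hπ : Function.Surjective π := Ideal.Quotient.mkₐ_surjective ℝ I
  have hkk : LinearMap.ker π = LinearMap.ker φ := by
    ext q
    rw [LinearMap.mem_ker, LinearMap.mem_ker]
    have : π q = 0 ↔ q ∈ I := Ideal.Quotient.eq_zero_iff_mem
    rw [this]
    exact ⟨hker1 q, hker2 q⟩
  let E : A ≃ₗ[ℝ] ((Fin n → Fin d) → ℝ) :=
    (π.quotKerEquivOfSurjective hπ).symm.trans
      ((Submodule.quotEquivOfEq _ _ hkk).trans (φ.quotKerEquivOfSurjective hφ))
  have : FiniteDimensional ℝ A := Module.Finite.equiv E.symm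
  have hrank : Odd (Module.finrank ℝ A) := by
    rw [E.finrank_eq, Module.finrank_fintype_fun_eq_card]
    simpa using hd.pow
  obtain ⟨v, a, hv, ha⟩ := pp_common_eigen
    (fun i : Fin n => LinearMap.mulLeft ℝ (Ideal.Quotient.mk I (X i) : A))
    (fun i j v => mul_left_comm _ _ _) hrank
  have hmul : ∀ p : MvPolynomial (Fin n) ℝ, (Ideal.Quotient.mk I p : A) * v = eval a p • v := by
    intro p
    induction p using MvPolynomial.induction_on with
    | C c =>
      obtain ⟨w, hw⟩ := Ideal.Quotient.mk_surjective v
      rw [eval_C, ← hw, ← map_mul, ← smul_eq_C_mul]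
      rfl
    | add p q hp hq => rw [map_add, add_mul, hp, hq, map_add, add_smul]
    | mul_X p i hp =>
      have := ha i
      rw [LinearMap.mulLeft_apply] at this
      rw [map_mul, mul_assoc, this, mul_smul_comm, hp, smul_smul, map_mul, eval_X, mul_comm]
  refine ⟨a, fun i => ?_⟩
  have h := hmul (F i)
  have h0 : (Ideal.Quotient.mk I (F i) : A) = 0 :=
    Ideal.Quotient.eq_zero_iff_mem.mpr (Ideal.subset_span ⟨i, rfl⟩)
  rw [h0, zero_mul] at h
  exact (smul_eq_zero.mp h.symm).resolve_right hv

lemma pp_common_zero_large {n d : ℕ} (hd : Odd d) (f : Fin n → MvPolynomial (Fin n) ℝ)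
    (hf : ∀ i, (f i).totalDegree ≤ d) (B : ℝ) :
    ∃ s : ℝ, B < s ∧ ∃ z : Fin n → ℝ, ∀ i, z i ^ d + s * eval z (f i) = 0 := by
  have hc : (⋃ k, {s : ℝ | (ppM d (ppF d f s) k).det = 0}).Countable :=
    Set.countable_iUnion fun k => (pp_good_k d f k).countable
  obtain ⟨s, hs', hs, -⟩ := (hc.dense_compl ℝ).exists_between (lt_add_one B)
  simp only [Set.mem_compl_iff, Set.mem_iUnion, Set.mem_ofPred_eq, not_exists] at hs'
  obtain ⟨z, hz⟩ := pp_common_zero hd (ppF d f s) (fun i => by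
    refine (totalDegree_add _ _).trans (max_le (by rw [totalDegree_X_pow]) ?_)
    exact (totalDegree_mul _ _).trans (by rw [totalDegree_C, zero_add]; exact hf i)) hs'
  exact ⟨s, hs, z, fun i => by simpa [ppF] using hz i⟩
end partB
section partC
open MvPolynomial

lemma pp_totalDegree_aeval_le {m n : ℕ} (g : Fin m → MvPolynomial (Fin n) ℝ)
    (hg : ∀ i, (g i).totalDegree ≤ 1) (q : MvPolynomial (Fin m) ℝ) :
    (aeval g q).totalDegree ≤ q.totalDegree := by
  rw [aeval_def, eval₂_eq']
  refine totalDegree_finsetSum_le fun e he => ?_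
  refine (totalDegree_mul _ _).trans ?_
  rw [algebraMap_eq, totalDegree_C, zero_add]
  refine (totalDegree_finsetProd _ _).trans (le_trans ?_ (le_totalDegree he))
  rw [Finsupp.sum_fintype _ _ (by simp)]
  refine Finset.sum_le_sum fun i _ => (totalDegree_pow _ _).trans ?_
  exact (Nat.mul_le_mul_left _ (hg i)).trans (by simp)

lemma pp_eval_smul {m d : ℕ} {q : MvPolynomial (Fin m) ℝ} (hq : q.IsHomogeneous d) (c : ℝ)
    (x : Fin m → ℝ) : eval (c • x) q = c ^ d * eval x q := by
  rw [eval_eq', eval_eq', Finset.mul_sum]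
  refine Finset.sum_congr rfl fun e he => ?_
  have := hq (mem_support_iff.mp he)
  simp only [Pi.smul_apply, smul_eq_mul, mul_pow, Finset.prod_mul_distrib, Finset.prod_pow_eq_pow_sum]
  have h2 : ∑ i, e i = d := by
    rw [← this, Finsupp.weight_apply, Finsupp.sum_fintype _ _ (by simp)]; simp
  rw [h2]; ring

lemma pp_BU_homog {n d : ℕ} (hd : Odd d) (q : Fin n → MvPolynomial (Fin (n + 1)) ℝ)
    (hq : ∀ i, (q i).IsHomogeneous d) :
    ∃ x : Fin (n + 1) → ℝ, x ≠ 0 ∧ ∀ i, eval x (q i) = 0 := by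
  have hcomp : IsCompact (Metric.sphere (0 : Fin (n + 1) → ℝ) 1) := isCompact_sphere _ _
  have hne : (Metric.sphere (0 : Fin (n + 1) → ℝ) 1).Nonempty :=
    NormedSpace.sphere_nonempty.mpr zero_le_one
  have hcont : Continuous fun x : Fin (n + 1) → ℝ => ∑ i, |eval x (q i)| := by
    refine continuous_finsetSum _ fun i _ => ?_
    exact (MvPolynomial.continuous_eval (q i)).abs
  obtain ⟨x, hx, hmin⟩ := hcomp.exists_isMinOn hne hcont.continuousOn
  have hx1 : ‖x‖ = 1 := by simpa using hx
  refine ⟨x, fun h => by simp [h] at hx1, ?_⟩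
  let f : Fin n → MvPolynomial (Fin n) ℝ := fun i => aeval (Fin.cons 1 X) (q i)
  have hf : ∀ i, (f i).totalDegree ≤ d := fun i =>
    (pp_totalDegree_aeval_le _ (fun j => by
      refine Fin.cases ?_ (fun j => ?_) j <;> simp) _).trans (hq i).totalDegree_le
  have hfe : ∀ i (z : Fin n → ℝ), eval z (f i) = eval (Fin.cons 1 z) (q i) := by
    intro i z
    have : (eval z).comp (aeval (R := ℝ) (Fin.cons 1 X : Fin (n+1) → MvPolynomial (Fin n) ℝ)).toRingHom
        = eval (Fin.cons 1 z) := by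
      ext j
      · simp
      · refine Fin.cases ?_ (fun j => ?_) j <;> simp
    exact RingHom.congr_fun this (q i)
  have hsmall : ∀ k : ℕ, ∑ i, |eval x (q i)| ≤ n / ((k : ℝ) + 1) := by
    intro k
    obtain ⟨s, hs, z, hz⟩ := pp_common_zero_large hd f hf (k + 1)
    have hs0 : 0 < s := lt_trans (by positivity) hs
    set w : Fin (n + 1) → ℝ := Fin.cons 1 z with hw
    have hw0 : w ≠ 0 := fun h => by
      have := congrFun h 0
      simp [hw] at this
    set y := ‖w‖⁻¹ • w with hy
    have hy1 : ‖y‖ = 1 := by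
      rw [hy, norm_smul, norm_inv, norm_norm, inv_mul_cancel₀ (norm_ne_zero_iff.mpr hw0)]
    have hyi : ∀ i : Fin n, |eval y (q i)| ≤ 1 / ((k : ℝ) + 1) := by
      intro i
      have h1 : eval y (q i) = ‖w‖⁻¹ ^ d * eval w (q i) := pp_eval_smul (hq i) _ _
      have h2 : w i.succ ^ d + s * eval w (q i) = 0 := by
        have := hz i
        rw [hfe] at this
        simpa [hw] using this
      have h3 : s * eval y (q i) = -(y i.succ ^ d) := by
        rw [h1, hy, Pi.smul_apply, smul_eq_mul, mul_pow]
        linear_combination (‖w‖⁻¹ ^ d) * h2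
      have h4 : |y i.succ| ≤ 1 := by
        have := norm_le_pi_norm y i.succ
        rwa [hy1] at this
      have h5 : s * |eval y (q i)| ≤ 1 := by
        rw [← abs_of_pos hs0, ← abs_mul, h3, abs_neg, abs_pow]
        exact pow_le_one₀ (abs_nonneg _) h4
      rw [le_div_iff₀ (by positivity)]
      nlinarith [abs_nonneg (eval y (q i))]
    have := hmin (show y ∈ Metric.sphere (0 : Fin (n + 1) → ℝ) 1 by simpa using hy1)
    refine le_trans this ?_
    refine (Finset.sum_le_sum fun i _ => hyi i).trans ?_
    simp [div_eq_mul_inv]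
  have hzero : ∑ i, |eval x (q i)| ≤ 0 := by
    refine ge_of_tendsto' (x := Filter.atTop) (f := fun k : ℕ => (n : ℝ) / ((k : ℝ) + 1)) ?_ hsmall
    have := (tendsto_one_div_add_atTop_nhds_zero_nat (𝕜 := ℝ)).const_mul (n : ℝ)
    simpa [div_eq_mul_inv] using this
  have hz := le_antisymm hzero (Finset.sum_nonneg fun i _ => abs_nonneg _)
  rw [Finset.sum_eq_zero_iff_of_nonneg (fun i _ => abs_nonneg _)] at hz
  intro i
  exact abs_eq_zero.mp (hz i (Finset.mem_univ i))

/-- Euclidean unit sphere in coordinates. -/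
def ppS (m : ℕ) : Set (Fin m → ℝ) := {x | ∑ i, x i ^ 2 = 1}

lemma ppS_compact (m : ℕ) : IsCompact (ppS m) := by
  refine (isCompact_closedBall (0 : Fin m → ℝ) 1).of_isClosed_subset ?_ ?_
  · exact isClosed_eq (by fun_prop) continuous_const
  · intro x hx
    rw [mem_closedBall_zero_iff, pi_norm_le_iff_of_nonneg zero_le_one]
    intro i
    have h1 : x i ^ 2 ≤ ∑ i, x i ^ 2 :=
      Finset.single_le_sum (f := fun i => x i ^ 2) (fun i _ => sq_nonneg _) (Finset.mem_univ i)
    have hx' : ∑ i, x i ^ 2 = 1 := hx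
    rw [hx'] at h1
    exact (sq_le_one_iff_abs_le_one _).mp h1

lemma ppS_ne_zero {m : ℕ} {x : Fin m → ℝ} (hx : x ∈ ppS m) : x ≠ 0 := by
  rintro rfl
  simp [ppS] at hx

/-- homogenized odd part -/
noncomputable def ppOdd {m : ℕ} (K : ℕ) (p : MvPolynomial (Fin m) ℝ) : MvPolynomial (Fin m) ℝ :=
  ∑ j ∈ (Finset.range (K + 1)).filter Odd,
    homogeneousComponent j p * (∑ i, X i ^ 2) ^ ((K - j) / 2)

lemma ppOdd_homog {m : ℕ} {K : ℕ} (hK : Odd K) (p : MvPolynomial (Fin m) ℝ) :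
    (ppOdd K p).IsHomogeneous K := by
  refine IsHomogeneous.sum _ _ _ fun j hj => ?_
  rw [Finset.mem_filter, Finset.mem_range] at hj
  have h1 : (∑ i : Fin m, X i ^ 2 : MvPolynomial (Fin m) ℝ).IsHomogeneous 2 :=
    IsHomogeneous.sum _ _ _ fun i _ => isHomogeneous_X_pow i 2
  have h2 := (homogeneousComponent_isHomogeneous j p).mul (h1.pow ((K - j) / 2))
  have h3 : j + 2 * ((K - j) / 2) = K := by
    obtain ⟨a, ha⟩ := hK
    obtain ⟨b, hb⟩ := hj.2
    omega
  rwa [h3] at h2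

lemma ppOdd_eval {m : ℕ} {K : ℕ} (p : MvPolynomial (Fin m) ℝ) (hp : p.totalDegree ≤ K)
    {x : Fin m → ℝ} (hx : x ∈ ppS m) :
    eval x (ppOdd K p) = (eval x p - eval (-x) p) / 2 := by
  have hx' : ∑ i, x i ^ 2 = 1 := hx
  have hsum : p = ∑ j ∈ Finset.range (K + 1), homogeneousComponent j p := by
    conv_lhs => rw [← sum_homogeneousComponent p]
    refine Finset.sum_subset ?_ ?_
    · intro j; simp only [Finset.mem_range]; omega
    · intro j _ hj
      simp only [Finset.mem_range] at hj
      exact homogeneousComponent_eq_zero _ _ (by omega)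
  have hneg : ∀ j, eval (-x) (homogeneousComponent j p) =
      (-1) ^ j * eval x (homogeneousComponent j p) := fun j => by
    have := pp_eval_smul (homogeneousComponent_isHomogeneous j p) (-1) x
    simpa using this
  have e1 : eval x p = ∑ j ∈ Finset.range (K + 1), eval x (homogeneousComponent j p) := by
    conv_lhs => rw [hsum, map_sum]
  have e2 : eval (-x) p = ∑ j ∈ Finset.range (K + 1), eval (-x) (homogeneousComponent j p) := by
    conv_lhs => rw [hsum, map_sum]
  rw [e1, e2, ← Finset.sum_sub_distrib, Finset.sum_div, ppOdd, map_sum, Finset.sum_filter]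
  refine Finset.sum_congr rfl fun j _ => ?_
  rw [hneg]
  split_ifs with hj
  · simp [hx', hj.neg_one_pow]
  · rw [Nat.not_odd_iff_even] at hj
    simp [hj.neg_one_pow]

lemma pp_stone {m : ℕ} (g : (Fin m → ℝ) → ℝ) (hg : ContinuousOn g (ppS m)) {ε : ℝ} (hε : 0 < ε) :
    ∃ p : MvPolynomial (Fin m) ℝ, ∀ x ∈ ppS m, |eval x p - g x| < ε := by
  have : CompactSpace (ppS m) := isCompact_iff_compactSpace.mp (ppS_compact m)
  let ev : MvPolynomial (Fin m) ℝ →ₐ[ℝ] C(ppS m, ℝ) :=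
    aeval fun i => ⟨fun x => x.1 i, (continuous_apply i).comp continuous_subtype_val⟩
  have hev : ∀ p (x : ppS m), ev p x = eval x.1 p := by
    intro p x
    induction p using MvPolynomial.induction_on with
    | C c => simp [ev]
    | add p q hp hq => simp [hp, hq]
    | mul_X p i hp => rw [map_mul, ContinuousMap.mul_apply, hp, map_mul]; simp [ev]
  have hsep : ev.range.SeparatesPoints := by
    intro x y hxy
    have : ∃ i, x.1 i ≠ y.1 i := by
      by_contra h
      push Not at h
      exact hxy (Subtype.ext (funext h))
    obtain ⟨i, hi⟩ := this
    refine ⟨ev (X i), ⟨ev (X i), ⟨X i, rfl⟩, rfl⟩, ?_⟩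
    rw [hev, hev]; simpa using hi
  obtain ⟨⟨_, p, rfl⟩, hp⟩ := ContinuousMap.exists_mem_subalgebra_near_continuous_of_separatesPoints
    ev.range hsep (fun x : ppS m => g x.1) (continuousOn_iff_continuous_domRestrict.mp hg) ε hε
  refine ⟨p, fun x hx => ?_⟩
  have := hp ⟨x, hx⟩
  rw [← hev p ⟨x, hx⟩]
  exact this

/-- Borsuk-Ulam. -/
lemma pp_borsuk_ulam {n : ℕ} (g : Fin n → (Fin (n + 1) → ℝ) → ℝ)
    (hg : ∀ i, ContinuousOn (g i) (ppS (n + 1))) (hodd : ∀ i x, g i (-x) = - g i x) :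
    ∃ x ∈ ppS (n + 1), ∀ i, g i x = 0 := by
  have hne : (ppS (n + 1)).Nonempty := ⟨Pi.single 0 1, by
    simp [ppS, Pi.single_apply]⟩
  have hcont : ContinuousOn (fun x : Fin (n + 1) → ℝ => ∑ i, |g i x|) (ppS (n + 1)) :=
    continuousOn_finsetSum _ fun i _ => (hg i).abs
  obtain ⟨x, hx, hmin⟩ := (ppS_compact (n + 1)).exists_isMinOn hne hcont
  refine ⟨x, hx, ?_⟩
  have hsmall : ∀ ε : ℝ, 0 < ε → ∑ i, |g i x| ≤ n * ε := by
    intro ε hε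
    choose p hp using fun i => pp_stone (g i) (hg i) hε
    set K := 2 * (∑ i, (p i).totalDegree) + 1 with hK
    have hpK : ∀ i, (p i).totalDegree ≤ K := fun i => by
      have := Finset.single_le_sum (f := fun i => (p i).totalDegree) (fun i _ => Nat.zero_le _)
        (Finset.mem_univ i)
      omega
    have hKodd : Odd K := ⟨_, hK⟩
    obtain ⟨w, hw0, hw⟩ := pp_BU_homog hKodd (fun i => ppOdd K (p i)) (fun i => ppOdd_homog hKodd _)
    have hpos : 0 < ∑ i, w i ^ 2 := by
      obtain ⟨i, hi⟩ := Function.ne_iff.mp hw0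
      exact Finset.sum_pos' (fun i _ => sq_nonneg _) ⟨i, Finset.mem_univ i, by
        have : w i ≠ 0 := hi
        positivity⟩
    set r := Real.sqrt (∑ i, w i ^ 2) with hr
    have hr0 : 0 < r := Real.sqrt_pos.mpr hpos
    have hr2 : r ^ 2 = ∑ i, w i ^ 2 := Real.sq_sqrt hpos.le
    set y := r⁻¹ • w with hy
    have hyS : y ∈ ppS (n + 1) := by
      change ∑ i, y i ^ 2 = 1
      simp only [hy, Pi.smul_apply, smul_eq_mul, mul_pow]
      rw [← Finset.mul_sum, ← hr2]
      field_simp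
    have hyS' : -y ∈ ppS (n + 1) := by
      change ∑ i, (-y) i ^ 2 = 1
      have h : ∑ i, y i ^ 2 = 1 := hyS
      simpa using h
    have hyi : ∀ i, |g i y| ≤ ε := by
      intro i
      have h1 : eval y (ppOdd K (p i)) = 0 := by
        rw [hy, pp_eval_smul (ppOdd_homog hKodd _), hw, mul_zero]
      rw [ppOdd_eval _ (hpK i) hyS] at h1
      have h2 := hp i y hyS
      have h3 := hp i (-y) hyS'
      rw [hodd] at h3
      rw [abs_lt] at h2 h3
      rw [abs_le]
      constructor <;> linarith [h2.1, h2.2, h3.1, h3.2]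
    refine (hmin hyS).trans ((Finset.sum_le_sum fun i _ => hyi i).trans ?_)
    simp
  have hzero : ∑ i, |g i x| ≤ 0 := by
    refine le_of_forall_pos_le_add fun δ hδ => ?_
    have := hsmall (δ / (n + 1)) (by positivity)
    refine this.trans ?_
    rw [zero_add, mul_div_assoc', div_le_iff₀ (by positivity)]
    nlinarith
  have hz := le_antisymm hzero (Finset.sum_nonneg fun i _ => abs_nonneg _)
  rw [Finset.sum_eq_zero_iff_of_nonneg (fun i _ => abs_nonneg _)] at hz
  intro i
  exact abs_eq_zero.mp (hz i (Finset.mem_univ i))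
end partC
section partD
open MvPolynomial

lemma pp_sign_continuousAt {x : ℝ} (hx : x ≠ 0) :
    ContinuousAt (fun y : ℝ => ((SignType.sign y : SignType) : ℝ)) x := by
  have h := continuousAt_sign_of_ne_zero hx
  exact (continuous_of_discreteTopology (f := fun s : SignType => (s : ℝ))).continuousAt.comp h

lemma pp_ham_sandwich {e N : ℕ} (μ : Measure (Fin e → ℝ)) [IsFiniteMeasure μ]
    (hμ : ∀ Q : MvPolynomial (Fin e) ℝ, Q ≠ 0 → μ {z | eval z Q = 0} = 0)
    (O : Fin N → Set (Fin e → ℝ)) (hO : ∀ i, MeasurableSet (O i)) (r : ℕ) (hr : N < r ^ e) :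
    ∃ Q : MvPolynomial (Fin e) ℝ, Q ≠ 0 ∧ Q.totalDegree ≤ e * r ∧
      ∀ i, μ (O i ∩ {z | 0 < eval z Q}) = μ (O i ∩ {z | eval z Q < 0}) := by
  have hcard : Fintype.card (Fin (N + 1)) ≤ Fintype.card (Fin e → Fin r) := by
    simpa using hr
  obtain ⟨em⟩ := Function.Embedding.nonempty_of_card_le hcard
  let mo : Fin (N + 1) → (Fin e →₀ ℕ) := fun j => ppBox e r (em j)
  have hmo : Function.Injective mo := (ppBox_inj e r).comp em.injective
  let f : (Fin (N + 1) → ℝ) → MvPolynomial (Fin e) ℝ := fun a => ∑ j, monomial (mo j) (a j)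
  have hf0 : ∀ a, a ≠ 0 → f a ≠ 0 := by
    intro a ha h
    refine ha (funext fun j => ?_)
    have := congrArg (coeff (mo j)) h
    simpa [f, coeff_sum, coeff_monomial, hmo.eq_iff] using this
  have hfdeg : ∀ a, (f a).totalDegree ≤ e * r := by
    intro a
    refine totalDegree_finsetSum_le fun j _ => (totalDegree_monomial_le _ _).trans ?_
    rw [Finsupp.sum_fintype _ _ (by simp)]
    refine (Finset.sum_le_card_nsmul _ _ r fun i _ => ?_).trans (by simp)
    exact (em j i).2.le
  have hfneg : ∀ a z, eval z (f (-a)) = - eval z (f a) := by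
    intro a z
    simp [f, map_sum, eval_monomial]
  have hfcont : ∀ z, Continuous fun a => eval z (f a) := by
    intro z
    simp only [f, map_sum, eval_monomial]
    fun_prop
  let g : Fin N → (Fin (N + 1) → ℝ) → ℝ := fun i a =>
    ∫ z in O i, ((SignType.sign (eval z (f a)) : SignType) : ℝ) ∂μ
  have hmeas : ∀ a, Measurable fun z => ((SignType.sign (eval z (f a)) : SignType) : ℝ) := by
    intro a
    have h1 : Measurable fun z => eval z (f a) := (MvPolynomial.continuous_eval (f a)).measurable
    have h2 : Measurable fun y : ℝ => ((SignType.sign y : SignType) : ℝ) := by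
      have : (fun y : ℝ => ((SignType.sign y : SignType) : ℝ)) =
          fun y => if 0 < y then 1 else if y < 0 then -1 else 0 := by
        funext y
        rw [sign_apply]
        split_ifs <;> simp
      rw [this]
      exact Measurable.ite measurableSet_Ioi measurable_const
        (Measurable.ite measurableSet_Iio measurable_const measurable_const)
    exact h2.comp h1
  have hbd : ∀ s : SignType, ‖(s : ℝ)‖ ≤ 1 := by
    intro s; cases s <;> simp
  have hgc : ∀ i, ContinuousOn (g i) (ppS (N + 1)) := by
    intro i a ha
    refine ContinuousAt.continuousWithinAt ?_
    refine continuousAt_of_dominated (bound := fun _ => (1 : ℝ)) ?_ ?_ ?_ ?_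
    · exact Filter.Eventually.of_forall fun b => (hmeas b).aestronglyMeasurable
    · exact Filter.Eventually.of_forall fun b => Filter.Eventually.of_forall fun z => hbd _
    · exact integrable_const _
    · refine ae_restrict_of_ae ?_
      have h0 := hμ _ (hf0 a (ppS_ne_zero ha))
      have h0' : ∀ᵐ z ∂μ, eval z (f a) ≠ 0 := by
        rw [ae_iff]; simpa using h0
      filter_upwards [h0'] with z hz
      exact ContinuousAt.comp (f := fun b => eval z (f b)) (pp_sign_continuousAt hz)
        (hfcont z).continuousAt
  have hgo : ∀ i a, g i (-a) = - g i a := by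
    intro i a
    simp only [g]
    rw [← integral_neg]
    congr 1
    funext z
    rw [hfneg, Left.sign_neg]
    simp
  obtain ⟨a, ha, hga⟩ := pp_borsuk_ulam g hgc hgo
  refine ⟨f a, hf0 a (ppS_ne_zero ha), hfdeg a, fun i => ?_⟩
  have hcont : Continuous fun z => eval z (f a) := MvPolynomial.continuous_eval (f a)
  have hp : MeasurableSet {z | 0 < eval z (f a)} := measurableSet_lt measurable_const hcont.measurable
  have hn : MeasurableSet {z | eval z (f a) < 0} := measurableSet_lt hcont.measurable measurable_const
  have h := hga i
  have hsplit : (fun z => ((SignType.sign (eval z (f a)) : SignType) : ℝ)) =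
      fun z => Set.indicator {z | 0 < eval z (f a)} (fun _ => (1 : ℝ)) z -
        Set.indicator {z | eval z (f a) < 0} (fun _ => (1 : ℝ)) z := by
    funext z
    rcases lt_trichotomy (eval z (f a)) 0 with h | h | h
    · simp [Set.indicator, h, h.not_gt]
    · simp [Set.indicator, h]
    · simp [Set.indicator, h, h.not_gt]
  simp only [g] at h
  rw [hsplit, integral_sub ((integrable_const _).indicator hp) ((integrable_const _).indicator hn),
    integral_indicator_const _ hp, integral_indicator_const _ hn, sub_eq_zero] at h
  simp only [smul_eq_mul, mul_one, Measure.real] at h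
  rw [ENNReal.toReal_eq_toReal_iff' (measure_ne_top _ _) (measure_ne_top _ _),
    Measure.restrict_apply hp, Measure.restrict_apply hn] at h
  rwa [Set.inter_comm, Set.inter_comm (O i)]

lemma pp_step {e N : ℕ} (μ : Measure (Fin e → ℝ)) [IsFiniteMeasure μ]
    (hμ : ∀ Q : MvPolynomial (Fin e) ℝ, Q ≠ 0 → μ {z | eval z Q = 0} = 0)
    (P : MvPolynomial (Fin e) ℝ) (hP : P ≠ 0)
    (O : Fin N → Set (Fin e → ℝ)) (hO : ∀ i, IsOpen (O i))
    (hdis : Pairwise (Function.onFun Disjoint O)) (hU : {z | eval z P ≠ 0} = ⋃ i, O i)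
    (r : ℕ) (hr : N < r ^ e) :
    ∃ (P' : MvPolynomial (Fin e) ℝ) (O' : Fin (N * 2) → Set (Fin e → ℝ)),
      P' ≠ 0 ∧ P'.totalDegree ≤ P.totalDegree + e * r ∧ (∀ i, IsOpen (O' i)) ∧
      Pairwise (Function.onFun Disjoint O') ∧ {z | eval z P' ≠ 0} = ⋃ i, O' i ∧
      ∀ i, ∃ j, 2 * μ (O' i) = μ (O j) := by
  obtain ⟨Q, hQ0, hQd, hQ⟩ := pp_ham_sandwich μ hμ O (fun i => (hO i).measurableSet) r hr
  have hcont : Continuous fun z => eval z Q := MvPolynomial.continuous_eval Q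
  let S : Fin 2 → Set (Fin e → ℝ) := ![{z | 0 < eval z Q}, {z | eval z Q < 0}]
  have hS : ∀ b, IsOpen (S b) := by
    intro b
    fin_cases b
    · exact isOpen_lt continuous_const hcont
    · exact isOpen_lt hcont continuous_const
  have hSd : ∀ b c, b ≠ c → Disjoint (S b) (S c) := by
    have h01 : Disjoint (S 0) (S 1) := by
      rw [Set.disjoint_left]
      intro z (h1 : 0 < eval z Q) (h2 : eval z Q < 0)
      exact lt_asymm h1 h2
    intro b c hbc
    fin_cases b <;> fin_cases c
    · exact absurd rfl hbc
    · exact h01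
    · exact h01.symm
    · exact absurd rfl hbc
  let E : Fin (N * 2) ≃ Fin N × Fin 2 := finProdFinEquiv.symm
  have hhalf : ∀ i, μ (O i) = μ (O i ∩ S 0) + μ (O i ∩ S 1) := by
    intro i
    rw [← measure_union ((hSd 0 1 (by decide)).mono Set.inter_subset_right Set.inter_subset_right)
      ((hO i).inter (hS 1)).measurableSet]
    refine le_antisymm ?_ (measure_mono (Set.union_subset Set.inter_subset_left Set.inter_subset_left))
    have : O i ⊆ ((O i ∩ S 0) ∪ (O i ∩ S 1)) ∪ {z | eval z Q = 0} := by
      intro z hz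
      rcases lt_trichotomy (eval z Q) 0 with h | h | h
      · exact Or.inl (Or.inr ⟨hz, h⟩)
      · exact Or.inr h
      · exact Or.inl (Or.inl ⟨hz, h⟩)
    refine (measure_mono this).trans ((measure_union_le _ _).trans ?_)
    rw [hμ Q hQ0, add_zero]
  have hQ' : ∀ i, μ (O i ∩ S 0) = μ (O i ∩ S 1) := hQ
  refine ⟨P * Q, fun k => O (E k).1 ∩ S (E k).2, mul_ne_zero hP hQ0,
    (totalDegree_mul _ _).trans (Nat.add_le_add_left hQd _),
    fun k => (hO _).inter (hS _), ?_, ?_, ?_⟩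
  · intro k l hkl
    by_cases h1 : (E k).1 = (E l).1
    · have h2 : (E k).2 ≠ (E l).2 := fun h2 => hkl (E.injective (Prod.ext h1 h2))
      exact (hSd _ _ h2).mono Set.inter_subset_right Set.inter_subset_right
    · exact (hdis h1).mono Set.inter_subset_left Set.inter_subset_left
  · ext z
    have hPz : eval z P ≠ 0 ↔ ∃ i, z ∈ O i := by
      have := Set.ext_iff.mp hU z
      simpa using this
    have hQz : eval z Q ≠ 0 ↔ ∃ b, z ∈ S b := by
      rw [Fin.exists_fin_two]
      change _ ↔ 0 < eval z Q ∨ eval z Q < 0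
      rw [ne_iff_lt_or_gt, or_comm]
    have : eval z (P * Q) ≠ 0 ↔ ∃ k, z ∈ O (E k).1 ∩ S (E k).2 := by
      rw [map_mul, mul_ne_zero_iff, hPz, hQz]
      constructor
      · rintro ⟨⟨i, hi⟩, b, hb⟩
        exact ⟨E.symm (i, b), by simpa using ⟨hi, hb⟩⟩
      · rintro ⟨k, hk⟩
        exact ⟨⟨_, hk.1⟩, _, hk.2⟩
    rw [Set.mem_iUnion]
    exact this
  · intro k
    refine ⟨(E k).1, ?_⟩
    have h : μ (O (E k).1 ∩ S (E k).2) = μ (O (E k).1 ∩ S 0) := by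
      generalize (E k).2 = b
      fin_cases b
      · rfl
      · exact (hQ' _).symm
    rw [h, hhalf, ← hQ', two_mul]

/-- partition into `2^s` pieces -/
def ppPart {e : ℕ} (μ : Measure (Fin e → ℝ)) (s B : ℕ) : Prop :=
  ∃ (P : MvPolynomial (Fin e) ℝ) (O : Fin (2 ^ s) → Set (Fin e → ℝ)),
      P ≠ 0 ∧ P.totalDegree ≤ B ∧ (∀ i, IsOpen (O i)) ∧
      Pairwise (Function.onFun Disjoint O) ∧ {z | eval z P ≠ 0} = ⋃ i, O i ∧
      ∀ i, 2 ^ s * μ (O i) = μ Set.univ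

lemma ppPart_zero {e : ℕ} (μ : Measure (Fin e → ℝ)) : ppPart μ 0 0 := by
  refine ⟨1, fun _ => Set.univ, one_ne_zero, by simp, fun _ => isOpen_univ, ?_, ?_, ?_⟩
  · intro i j hij
    have hi := i.2
    have hj := j.2
    exact absurd (Fin.ext (by omega)) hij
  · ext z
    have : Nonempty (Fin (2 ^ 0)) := ⟨⟨0, by norm_num⟩⟩
    simp
  · simp

lemma ppPart_succ {e : ℕ} (μ : Measure (Fin e → ℝ)) [IsFiniteMeasure μ]
    (hμ : ∀ Q : MvPolynomial (Fin e) ℝ, Q ≠ 0 → μ {z | eval z Q = 0} = 0)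
    {s B : ℕ} (h : ppPart μ s B) (r : ℕ) (hr : 2 ^ s < r ^ e) : ppPart μ (s + 1) (B + e * r) := by
  obtain ⟨P, O, hP, hd, hO, hdis, hU, hm⟩ := h
  obtain ⟨P', O', hP', hd', hO', hdis', hU', hm'⟩ := pp_step μ hμ P hP O hO hdis hU r hr
  refine ⟨P', O', hP', hd'.trans (by omega), hO', hdis', hU', fun i => ?_⟩
  obtain ⟨j, hj⟩ := hm' i
  rw [pow_succ, mul_assoc, ← hm j, ← hj]

lemma ppPart_block {e : ℕ} (μ : Measure (Fin e → ℝ)) [IsFiniteMeasure μ]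
    (hμ : ∀ Q : MvPolynomial (Fin e) ℝ, Q ≠ 0 → μ {z | eval z Q = 0} = 0)
    {t B : ℕ} (h : ppPart μ (e * t) B) :
    ∀ l ≤ e, ppPart μ (e * t + l) (B + l * (e * 2 ^ (t + 1))) := by
  intro l
  induction l with
  | zero => intro _; simpa using h
  | succ l ih =>
    intro hl
    have := ppPart_succ μ hμ (ih (by omega)) (2 ^ (t + 1)) (by
      rw [← pow_mul]
      refine Nat.pow_lt_pow_right (by norm_num) ?_
      nlinarith)
    have h2 : B + (l + 1) * (e * 2 ^ (t + 1)) = B + l * (e * 2 ^ (t + 1)) + e * 2 ^ (t + 1) := by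
      ring
    rw [h2]
    exact this

lemma ppPart_all {e : ℕ} (μ : Measure (Fin e → ℝ)) [IsFiniteMeasure μ]
    (hμ : ∀ Q : MvPolynomial (Fin e) ℝ, Q ≠ 0 → μ {z | eval z Q = 0} = 0) (t : ℕ) :
    ppPart μ (e * t) (2 * e ^ 2 * (2 ^ t - 1)) := by
  induction t with
  | zero => simpa using ppPart_zero μ
  | succ t ih =>
    have := ppPart_block μ hμ ih e le_rfl
    have h1 : e * (t + 1) = e * t + e := by ring
    rw [h1]
    convert this using 1
    obtain ⟨k, hk⟩ : ∃ k, 2 ^ t = k + 1 := ⟨2 ^ t - 1, (Nat.sub_add_cancel Nat.one_le_two_pow).symm⟩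
    have h2 : 2 ^ (t + 1) = 2 * k + 2 := by rw [pow_succ, hk]; ring
    rw [h2, hk, Nat.add_sub_cancel, show 2 * k + 2 - 1 = 2 * k + 1 by omega]
    ring
end partD

theorem stmt3 (n : ℕ) :
    ∃ c : ℝ, 0 < c ∧
      ∀ (μ : Measure (Fin (n + 1) → ℝ)), IsFiniteMeasure μ →
        (∀ Q : MvPolynomial (Fin (n + 1)) ℝ, Q ≠ 0 →
          μ {z | MvPolynomial.eval z Q = 0} = 0) →
        ∀ D : ℕ, 1 ≤ D →
          ∃ (P : MvPolynomial (Fin (n + 1)) ℝ) (m : ℕ) (O : Fin m → Set (Fin (n + 1) → ℝ)),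
            P ≠ 0 ∧ P.totalDegree ≤ D ∧
            (∀ i, IsOpen (O i)) ∧
            Pairwise (Function.onFun Disjoint O) ∧
            {z | MvPolynomial.eval z P ≠ 0} = ⋃ i, O i ∧
            ((D : ℝ) ^ (n + 1) / c ≤ (m : ℝ) ∧ (m : ℝ) ≤ c * (D : ℝ) ^ (n + 1)) ∧
            ∀ i, μ Set.univ ≤ ENNReal.ofReal (c * (D : ℝ) ^ (n + 1)) * μ (O i) := by
  have hc1 : (1 : ℝ) ≤ (4 * ((n : ℝ) + 1) ^ 2) ^ (n + 1) := by
    refine one_le_pow₀ ?_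
    nlinarith [(Nat.cast_nonneg n : (0 : ℝ) ≤ n)]
  refine ⟨(4 * ((n : ℝ) + 1) ^ 2) ^ (n + 1), lt_of_lt_of_le one_pos hc1, ?_⟩
  intro μ hfin hμ D hD
  set q := D / (2 * (n + 1) ^ 2) with hq
  set t := Nat.log 2 q with ht
  obtain ⟨P, O, hP, hd, hO, hdis, hU, hm⟩ := ppPart_all μ hμ t
  have hpos : 0 < 2 * (n + 1) ^ 2 := by positivity
  have hqD : q * (2 * (n + 1) ^ 2) ≤ D := Nat.div_mul_le_self _ _
  have hlt : D < 2 ^ (t + 1) * (2 * (n + 1) ^ 2) := by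
    rw [← Nat.div_lt_iff_lt_mul hpos]
    exact Nat.lt_pow_succ_log_self (by norm_num) q
  have hdeg : 2 * (n + 1) ^ 2 * (2 ^ t - 1) ≤ D := by
    rcases Nat.eq_zero_or_pos q with h0 | h0
    · simp [ht, h0]
    · have := Nat.pow_log_le_self 2 h0.ne'
      calc 2 * (n + 1) ^ 2 * (2 ^ t - 1) ≤ 2 * (n + 1) ^ 2 * q :=
            Nat.mul_le_mul_left _ ((Nat.sub_le _ _).trans this)
        _ ≤ D := by rw [mul_comm]; exact hqD
  have htD : 2 ^ t ≤ D := by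
    rcases Nat.eq_zero_or_pos q with h0 | h0
    · simpa [ht, h0] using hD
    · exact (Nat.pow_log_le_self 2 h0.ne').trans (Nat.div_le_self _ _)
  have hmD : (2 : ℝ) ^ ((n + 1) * t) ≤ (D : ℝ) ^ (n + 1) := by
    rw [mul_comm, pow_mul]
    gcongr
    exact_mod_cast htD
  have hup : (2 : ℝ) ^ ((n + 1) * t) ≤ (4 * ((n : ℝ) + 1) ^ 2) ^ (n + 1) * (D : ℝ) ^ (n + 1) := by
    refine hmD.trans (le_mul_of_one_le_left (by positivity) hc1)
  refine ⟨P, 2 ^ ((n + 1) * t), O, hP, hd.trans hdeg, hO, hdis, hU, ⟨?_, ?_⟩, ?_⟩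
  · rw [div_le_iff₀ (by positivity)]
    push_cast
    rw [mul_comm (n + 1) t, pow_mul, ← mul_pow]
    gcongr
    have : (D : ℝ) < 2 ^ (t + 1) * (2 * ((n : ℝ) + 1) ^ 2) := by exact_mod_cast hlt
    rw [pow_succ] at this
    linarith
  · push_cast
    exact hup
  · intro i
    rw [← hm i]
    gcongr
    rw [ENNReal.le_ofReal_iff_toReal_le (by simp) (by positivity)]
    simpa using hup
end
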